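/- arXiv:1711.09741 — 3 statements merged into one kernel-verified Lean document; each statement's English description precedes it below -/
import Mathlib

section
/- Fix ε > 0, set m = ⌈(1+ε)n⌉ and p = (2/(1+ε))·(log n − log log n)/n. Let Q = Q_n be a monotone increasing property of n×n×m 0-1 arrays such that every array with property Q has no empty shaft. If the probability that M ~ M≥1(n,n,m;p) satisfies Q tends to 1 as n → ∞, then for a uniformly random (n,n,m)-array process M̃, with probability tending to 1, τ(M̃;Q) = τ(M̃; no empty shafts). -/
attribute [local instance] Classical.propDecidable

noncomputable section

/-- The number of ones in an `m × n × k` 0-1 array. -/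
def numOnes {m n k : ℕ} (M : Fin m → Fin n → Fin k → Bool) : ℕ :=
  (Finset.univ.filter (fun x : Fin m × Fin n × Fin k => M x.1 x.2.1 x.2.2 = true)).card

/-- An `m × n × k` 0-1 array is a Latin box if it has exactly `m * n` ones and
every line (fixing two coordinates, varying the third) has at most one `1`. -/
def IsLatinBox {m n k : ℕ} (M : Fin m → Fin n → Fin k → Bool) : Prop :=
  numOnes M = m * n ∧
  (∀ i j, (Finset.univ.filter (fun c => M i j c = true)).card ≤ 1) ∧
  (∀ i c, (Finset.univ.filter (fun j => M i j c = true)).card ≤ 1) ∧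
  (∀ j c, (Finset.univ.filter (fun i => M i j c = true)).card ≤ 1)

/-- `M` contains (supports) a Latin box. -/
def ContainsLatinBox {m n k : ℕ} (M : Fin m → Fin n → Fin k → Bool) : Prop :=
  ∃ L : Fin m → Fin n → Fin k → Bool, IsLatinBox L ∧ ∀ i j c, L i j c = true → M i j c = true

/-- The probability that a random `m × n × k` 0-1 array, whose entries are
independently `1` with probability `p`, satisfies the property `P`. -/
def arrProb (m n k : ℕ) (p : ℝ) (P : (Fin m → Fin n → Fin k → Bool) → Prop) : ℝ :=
  ∑ M : Fin m → Fin n → Fin k → Bool,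
    if P M then ∏ i, ∏ j, ∏ c, (if M i j c = true then p else 1 - p) else 0

/-- The array at time `t` of the `(n,n,m)`-array process determined by the order `σ`
in which the `n·n·m` positions are switched from `0` to `1`. -/
def procArr (n m : ℕ) (σ : Fin (n * n * m) ≃ (Fin n × Fin n × Fin m)) (t : ℕ) :
    Fin n → Fin n → Fin m → Bool :=
  fun i j c => decide (∃ s : Fin (n * n * m), (s : ℕ) < t ∧ σ s = (i, j, c))

/-- The hitting time of a property `Q` in the array process determined by `σ`. -/
def hittingTime (n m : ℕ) (σ : Fin (n * n * m) ≃ (Fin n × Fin n × Fin m))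
    (Q : (Fin n → Fin n → Fin m → Bool) → Prop) : ℕ :=
  sInf {t : ℕ | Q (procArr n m σ t)}

/-- No shaft `(r,c,·)` of the `n × n × m` array is empty. -/
def NoEmptyShaft {n m : ℕ} (M : Fin n → Fin n → Fin m → Bool) : Prop :=
  ∀ r c, ∃ v, M r c v = true

/-- The array obtained from `A` by setting, in each empty shaft `(r,c,·)` of `A`, the
position `g r c` to `1`. -/
def fillArr (n m : ℕ) (A : Fin n → Fin n → Fin m → Bool) (g : Fin n → Fin n → Fin m) :
    Fin n → Fin n → Fin m → Bool :=
  fun r c v => A r c v || (decide (∀ w, A r c w = false) && decide (g r c = v))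

/-- Probability that `M ~ M≥1(n,n,m;p)` satisfies `P`: first `A ~ M(n,n,m;p)` is sampled
(i.i.d. Bernoulli(p) entries), and then in each empty shaft a uniformly random position
(independently over shafts) is changed to `1`. -/
def gbProb (n m : ℕ) (p : ℝ) (P : (Fin n → Fin n → Fin m → Bool) → Prop) : ℝ :=
  ∑ A : Fin n → Fin n → Fin m → Bool, ∑ g : Fin n → Fin n → Fin m,
    if P (fillArr n m A g) then
      (∏ r, ∏ c, ∏ v, if A r c v = true then p else 1 - p) * (1 / (m : ℝ) ^ (n * n))
    else 0
/-- The position, within each shaft, of the entry which the order `σ` switches on first. -/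
def firstPos {n m : ℕ} [NeZero m] (σ : Fin (n * n * m) ≃ (Fin n × Fin n × Fin m))
    (r c : Fin n) : Fin m :=
  (Finite.exists_min (fun v => σ.symm (r, c, v))).choose

lemma firstPos_le {n m : ℕ} [NeZero m] (σ : Fin (n * n * m) ≃ (Fin n × Fin n × Fin m))
    (r c : Fin n) (v : Fin m) : σ.symm (r, c, firstPos σ r c) ≤ σ.symm (r, c, v) :=
  (Finite.exists_min (fun v => σ.symm (r, c, v))).choose_spec v

lemma eq_firstPos {n m : ℕ} [NeZero m] (σ : Fin (n * n * m) ≃ (Fin n × Fin n × Fin m))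
    (r c : Fin n) (w : Fin m) (hw : ∀ v, σ.symm (r, c, w) ≤ σ.symm (r, c, v)) :
    firstPos σ r c = w := by
  have h := σ.symm.injective (le_antisymm (firstPos_le σ r c w) (hw _))
  simpa using h

/-- Rotation of each shaft by the prescribed amount. -/
def shaftRotation {n m : ℕ} [NeZero m] (h : Fin n → Fin n → Fin m) :
    (Fin n × Fin n × Fin m) ≃ (Fin n × Fin n × Fin m) where
  toFun x := (x.1, x.2.1, x.2.2 + h x.1 x.2.1)
  invFun x := (x.1, x.2.1, x.2.2 - h x.1 x.2.1)
  left_inv x := by simp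
  right_inv x := by simp

lemma firstPos_rotation {n m : ℕ} [NeZero m] (σ : Fin (n * n * m) ≃ (Fin n × Fin n × Fin m))
    (h : Fin n → Fin n → Fin m) (r c : Fin n) :
    firstPos (σ.trans (shaftRotation h)) r c = firstPos σ r c + h r c := by
  apply eq_firstPos
  intro v
  simpa [shaftRotation] using firstPos_le σ r c (v - h r c)

lemma procArr_eq_true {n m : ℕ} (σ : Fin (n * n * m) ≃ (Fin n × Fin n × Fin m)) (t : ℕ)
    (r c : Fin n) (v : Fin m) :
    procArr n m σ t r c v = true ↔ (σ.symm (r, c, v) : ℕ) < t := by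
  simp only [procArr, decide_eq_true_eq]
  constructor
  · rintro ⟨s, hs, h⟩
    rwa [← h, Equiv.symm_apply_apply]
  · intro h
    exact ⟨_, h, by simp⟩

lemma procArr_trans_eq_iff {n m : ℕ} (σ : Fin (n * n * m) ≃ (Fin n × Fin n × Fin m)) (t : ℕ)
    (ρ : (Fin n × Fin n × Fin m) ≃ (Fin n × Fin n × Fin m)) (A B : Fin n → Fin n → Fin m → Bool)
    (hρ : ∀ x, B (ρ x).1 (ρ x).2.1 (ρ x).2.2 = A x.1 x.2.1 x.2.2) :
    procArr n m (σ.trans ρ) t = B ↔ procArr n m σ t = A := by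
  have key : ∀ x : Fin n × Fin n × Fin m,
      procArr n m (σ.trans ρ) t (ρ x).1 (ρ x).2.1 (ρ x).2.2
        = procArr n m σ t x.1 x.2.1 x.2.2 := by
    intro x
    rw [Bool.eq_iff_iff, procArr_eq_true, procArr_eq_true]
    simp
  constructor
  · intro h
    funext r c v
    rw [← key (r, c, v), h, hρ (r, c, v)]
  · intro h
    funext r c v
    obtain ⟨x, hx⟩ := ρ.surjective (r, c, v)
    have h1 := key x
    have h2 := hρ x
    rw [h, ← h2, hx] at h1
    exact h1

/-- The number of orders whose process passes through `A` at time `t`. -/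
def numOrders (n m t : ℕ) (A : Fin n → Fin n → Fin m → Bool) : ℕ :=
  (Finset.univ.filter (fun σ : Fin (n * n * m) ≃ (Fin n × Fin n × Fin m) =>
    procArr n m σ t = A)).card

lemma numOnes_procArr {n m : ℕ} (σ : Fin (n * n * m) ≃ (Fin n × Fin n × Fin m)) (t : ℕ)
    (ht : t ≤ n * n * m) : numOnes (procArr n m σ t) = t := by
  unfold numOnes
  have h : (Finset.univ.filter (fun x : Fin n × Fin n × Fin m =>
      procArr n m σ t x.1 x.2.1 x.2.2 = true)).card
      = (Finset.univ.filter (fun s : Fin (n * n * m) => (s : ℕ) < t)).card := by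
    refine Finset.card_nbij' σ.symm σ ?_ ?_ ?_ ?_
    · intro x hx
      simpa [procArr_eq_true] using hx
    · intro x hx
      simpa [procArr_eq_true] using hx
    · intro x _; simp
    · intro x _; simp
  rw [h, Fin.card_filter_val_lt, min_eq_right ht]

lemma numOrders_eq_of_numOnes_eq {n m t : ℕ} {A B : Fin n → Fin n → Fin m → Bool}
    (h : numOnes A = numOnes B) : numOrders n m t A = numOrders n m t B := by
  have e : {x : Fin n × Fin n × Fin m // A x.1 x.2.1 x.2.2 = true} ≃
      {x : Fin n × Fin n × Fin m // B x.1 x.2.1 x.2.2 = true} := by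
    apply Fintype.equivOfCardEq
    rw [Fintype.card_subtype, Fintype.card_subtype]
    exact h
  have hρ : ∀ x, B (e.extendSubtype x).1 (e.extendSubtype x).2.1 (e.extendSubtype x).2.2
      = A x.1 x.2.1 x.2.2 := by
    intro x
    by_cases hx : A x.1 x.2.1 x.2.2 = true
    · rw [hx]
      exact e.extendSubtype_mem x hx
    · have := e.extendSubtype_not_mem x hx
      simp only [Bool.not_eq_true] at this hx
      rw [hx, this]
  unfold numOrders
  refine Finset.card_nbij' (fun σ => σ.trans e.extendSubtype)
    (fun σ => σ.trans e.extendSubtype.symm) ?_ ?_ ?_ ?_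
  · intro σ hσ
    simpa [procArr_trans_eq_iff σ t _ A B hρ] using hσ
  · intro σ hσ
    have := procArr_trans_eq_iff (σ.trans e.extendSubtype.symm) t _ A B hρ
    have e' : (σ.trans e.extendSubtype.symm).trans e.extendSubtype = σ := by ext1 x; simp
    rw [e'] at this
    simpa [← this] using hσ
  · intro σ _; ext1 x; simp
  · intro σ _; ext1 x; simp

lemma card_numOnes_eq (n m t : ℕ) :
    (Finset.univ.filter (fun A : Fin n → Fin n → Fin m → Bool => numOnes A = t)).card
      = (n * n * m).choose t := by
  have h : (Finset.powersetCard t (Finset.univ : Finset (Fin n × Fin n × Fin m))).card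
      = (n * n * m).choose t := by
    rw [Finset.card_powersetCard]
    simp [mul_assoc]
  rw [← h]
  refine Finset.card_nbij'
    (fun A => Finset.univ.filter (fun x : Fin n × Fin n × Fin m => A x.1 x.2.1 x.2.2 = true))
    (fun s r c v => decide ((r, c, v) ∈ s)) ?_ ?_ ?_ ?_
  · intro A hA
    rw [Finset.mem_coe, Finset.mem_filter] at hA
    exact Finset.mem_powersetCard_univ.2 hA.2
  · intro s hs
    rw [Finset.mem_coe, Finset.mem_powersetCard_univ] at hs
    rw [Finset.mem_coe, Finset.mem_filter]
    simpa [numOnes] using hs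
  · intro A _
    funext r c v
    simp
  · intro s _
    ext x
    simp

lemma choose_mul_numOrders {n m t : ℕ} (ht : t ≤ n * n * m)
    {A : Fin n → Fin n → Fin m → Bool} (hA : numOnes A = t) :
    (n * n * m).choose t * numOrders n m t A
      = Fintype.card (Fin (n * n * m) ≃ (Fin n × Fin n × Fin m)) := by
  have h := Finset.card_eq_sum_card_fiberwise
    (s := (Finset.univ : Finset (Fin (n * n * m) ≃ (Fin n × Fin n × Fin m))))
    (f := fun σ => procArr n m σ t)
    (t := Finset.univ.filter (fun A : Fin n → Fin n → Fin m → Bool => numOnes A = t))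
    (fun σ _ => by simpa using numOnes_procArr σ t ht)
  rw [Finset.card_univ] at h
  rw [h, ← card_numOnes_eq n m t, ← smul_eq_mul, ← Finset.sum_const]
  refine Finset.sum_congr rfl fun B hB => ?_
  rw [Finset.mem_filter] at hB
  exact numOrders_eq_of_numOnes_eq (hA.trans hB.2.symm)

lemma numOnes_le {n m : ℕ} (A : Fin n → Fin n → Fin m → Bool) : numOnes A ≤ n * n * m := by
  refine (Finset.card_le_univ _).trans (le_of_eq ?_)
  simp [mul_assoc]

/-- The weight of the array `A` under independent Bernoulli entries. -/
def bernoulliWeight {n m : ℕ} (p : ℝ) (A : Fin n → Fin n → Fin m → Bool) : ℝ :=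
  ∏ r, ∏ c, ∏ v, if A r c v = true then p else 1 - p

lemma bernoulliWeight_eq_pow {n m : ℕ} (p : ℝ) (A : Fin n → Fin n → Fin m → Bool) :
    bernoulliWeight p A = p ^ numOnes A * (1 - p) ^ (n * n * m - numOnes A) := by
  have h : bernoulliWeight p A
      = ∏ x : Fin n × Fin n × Fin m, if A x.1 x.2.1 x.2.2 = true then p else 1 - p := by
    simp only [bernoulliWeight, Fintype.prod_prod_type]
  have hc := Finset.card_filter_add_card_filter_not
    (s := (Finset.univ : Finset (Fin n × Fin n × Fin m))) (fun x => A x.1 x.2.1 x.2.2 = true)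
  have hN : (Finset.univ : Finset (Fin n × Fin n × Fin m)).card = n * n * m := by
    simp [mul_assoc]
  rw [h, Finset.prod_ite, Finset.prod_const, Finset.prod_const]
  congr 2
  unfold numOnes
  omega

lemma bernoulliWeight_nonneg {n m : ℕ} {p : ℝ} (h0 : 0 ≤ p) (h1 : p ≤ 1)
    (A : Fin n → Fin n → Fin m → Bool) : 0 ≤ bernoulliWeight p A := by
  rw [bernoulliWeight_eq_pow]
  have : 0 ≤ 1 - p := by linarith
  positivity

/-- The binomial probability of `t` successes among `N` trials. -/
def binomialWeight (N : ℕ) (p : ℝ) (t : ℕ) : ℝ := N.choose t * p ^ t * (1 - p) ^ (N - t)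

lemma sum_binomialWeight (N : ℕ) (p : ℝ) :
    ∑ t ∈ Finset.range (N + 1), binomialWeight N p t = 1 := by
  have h := add_pow p (1 - p) N
  rw [add_sub_cancel, one_pow] at h
  rw [h]
  exact Finset.sum_congr rfl fun t _ => by unfold binomialWeight; ring

lemma binomialWeight_nonneg (N : ℕ) {p : ℝ} (h0 : 0 ≤ p) (h1 : p ≤ 1) (t : ℕ) :
    0 ≤ binomialWeight N p t := by
  have : 0 ≤ 1 - p := by linarith
  unfold binomialWeight
  positivity

lemma sum_binomialWeight_mul_numOrders {n m : ℕ} (p : ℝ) (A : Fin n → Fin n → Fin m → Bool) :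
    ∑ t ∈ Finset.range (n * n * m + 1), binomialWeight (n * n * m) p t * numOrders n m t A
      = Fintype.card (Fin (n * n * m) ≃ (Fin n × Fin n × Fin m)) * bernoulliWeight p A := by
  rw [Finset.sum_eq_single (numOnes A)]
  · have h := choose_mul_numOrders (numOnes_le A) (rfl : numOnes A = numOnes A)
    rw [← h, bernoulliWeight_eq_pow]
    unfold binomialWeight
    push_cast
    ring
  · intro t ht hne
    have : numOrders n m t A = 0 := by
      unfold numOrders
      rw [Finset.card_eq_zero, Finset.filter_eq_empty_iff]
      rintro σ - rfl
      exact hne (numOnes_procArr σ t (by simpa [Nat.lt_succ_iff] using ht)).symm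
    simp [this]
  · intro h
    exact absurd (Finset.mem_range.2 (Nat.lt_succ_of_le (numOnes_le A))) h

/-- On the orders passing through `A` at time `t`, the first positions in the shafts that are
empty in `A` are jointly uniform. -/
lemma sum_firstPos {n m : ℕ} [NeZero m] (t : ℕ) (A : Fin n → Fin n → Fin m → Bool)
    (F : (Fin n → Fin n → Fin m) → ℝ)
    (hF : ∀ g g', (∀ r c, (∀ w, A r c w = false) → g r c = g' r c) → F g = F g') :
    (m : ℝ) ^ (n * n) * ∑ σ : Fin (n * n * m) ≃ (Fin n × Fin n × Fin m),
        (if procArr n m σ t = A then F (firstPos σ) else 0)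
      = numOrders n m t A * ∑ g, F g := by
  have hrot : ∀ h : Fin n → Fin n → Fin m,
      ∑ σ : Fin (n * n * m) ≃ (Fin n × Fin n × Fin m),
        (if procArr n m σ t = A then F (firstPos σ) else 0)
      = ∑ σ : Fin (n * n * m) ≃ (Fin n × Fin n × Fin m),
        (if procArr n m σ t = A then F (firstPos σ + h) else 0) := by
    intro h
    set h' : Fin n → Fin n → Fin m :=
      fun r c => if ∀ w, A r c w = false then h r c else 0 with hh'
    rw [← Equiv.sum_comp (Equiv.equivCongr (Equiv.refl _) (shaftRotation h'))]
    refine Finset.sum_congr rfl fun σ _ => ?_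
    have e : Equiv.equivCongr (Equiv.refl _) (shaftRotation h') σ
        = σ.trans (shaftRotation h') := by
      ext1 x; simp
    have hA : ∀ x, A (shaftRotation h' x).1 (shaftRotation h' x).2.1 (shaftRotation h' x).2.2
        = A x.1 x.2.1 x.2.2 := by
      rintro ⟨r, c, v⟩
      simp only [shaftRotation, Equiv.coe_fn_mk, hh']
      split_ifs with hs
      · rw [hs, hs]
      · simp
    rw [e, if_congr (procArr_trans_eq_iff σ t _ A A hA) rfl rfl]
    congr 1
    apply hF
    intro r c hs
    rw [firstPos_rotation]
    simp [hh', hs]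
  have hcard : (m : ℝ) ^ (n * n)
      = (Finset.univ : Finset (Fin n → Fin n → Fin m)).card := by
    simp [pow_mul]
  rw [hcard, ← nsmul_eq_mul, ← Finset.sum_const, Finset.sum_congr rfl fun h _ => hrot h,
    Finset.sum_comm]
  unfold numOrders
  rw [Finset.card_filter, Nat.cast_sum, Finset.sum_mul]
  refine Finset.sum_congr rfl fun σ _ => ?_
  split_ifs
  · rw [Nat.cast_one, one_mul]
    exact Equiv.sum_comp (Equiv.addLeft (firstPos σ)) F
  · simp

/-- The process stopped at an independent binomial time, together with the first positions in
the shafts still empty, has the law of an i.i.d. Bernoulli array together with independent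
uniform positions. -/
lemma sum_binomialWeight_mul_sum_procArr {n m : ℕ} [NeZero m] (p : ℝ)
    (F : (Fin n → Fin n → Fin m → Bool) → (Fin n → Fin n → Fin m) → ℝ)
    (hF : ∀ A g g', (∀ r c, (∀ w, A r c w = false) → g r c = g' r c) → F A g = F A g') :
    ∑ t ∈ Finset.range (n * n * m + 1), binomialWeight (n * n * m) p t *
        ∑ σ : Fin (n * n * m) ≃ (Fin n × Fin n × Fin m), F (procArr n m σ t) (firstPos σ)
      = Fintype.card (Fin (n * n * m) ≃ (Fin n × Fin n × Fin m)) *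
        ∑ A, ∑ g, F A g * (bernoulliWeight p A * (1 / (m : ℝ) ^ (n * n))) := by
  have hm : (m : ℝ) ^ (n * n) ≠ 0 := pow_ne_zero _ (Nat.cast_ne_zero.2 (NeZero.ne m))
  have h1 : ∀ t, ∑ σ : Fin (n * n * m) ≃ (Fin n × Fin n × Fin m),
      F (procArr n m σ t) (firstPos σ)
      = ∑ A, (numOrders n m t A : ℝ) * ((∑ g, F A g) * (1 / (m : ℝ) ^ (n * n))) := by
    intro t
    have h2 : ∀ A, (numOrders n m t A : ℝ) * ((∑ g, F A g) * (1 / (m : ℝ) ^ (n * n)))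
        = ∑ σ : Fin (n * n * m) ≃ (Fin n × Fin n × Fin m),
          (if procArr n m σ t = A then F A (firstPos σ) else 0) := by
      intro A
      rw [← mul_assoc, ← sum_firstPos t A (F A) (hF A)]
      field_simp
    rw [Finset.sum_congr rfl fun A _ => h2 A, Finset.sum_comm]
    refine Finset.sum_congr rfl fun σ _ => ?_
    rw [Finset.sum_ite_eq]
    simp
  simp_rw [h1, Finset.mul_sum (s := (Finset.univ : Finset (Fin n → Fin n → Fin m → Bool)))]
  rw [Finset.sum_comm]
  refine Finset.sum_congr rfl fun A _ => ?_
  simp_rw [← mul_assoc]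
  rw [← Finset.sum_mul, ← Finset.sum_mul, sum_binomialWeight_mul_numOrders, ← Finset.sum_mul,
    ← Finset.sum_mul]
  ring

lemma sum_bernoulli_row (m : ℕ) (p : ℝ) :
    ∑ x : Fin m → Bool, ∏ v, (if x v = true then p else 1 - p) = 1 := by
  have h := Finset.prod_univ_sum (fun _ : Fin m => (Finset.univ : Finset Bool))
    (fun _ b => if b = true then p else 1 - p)
  rw [Fintype.piFinset_univ] at h
  rw [← h]
  simp

lemma arrProb_noEmptyShaft (n m : ℕ) (p : ℝ) :
    arrProb n n m p NoEmptyShaft = (1 - (1 - p) ^ m) ^ (n * n) := by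
  set f : (Fin m → Bool) → ℝ :=
    fun x => if ∃ v, x v = true then ∏ v, (if x v = true then p else 1 - p) else 0 with hf
  have hsum : ∑ x, f x = 1 - (1 - p) ^ m := by
    have h1 : ∀ x, f x = (∏ v, (if x v = true then p else 1 - p))
        - if x = (fun _ => false) then (1 - p) ^ m else 0 := by
      intro x
      by_cases hx : x = fun _ => false
      · simp [hf, hx]
      · have : ∃ v, x v = true := by
          by_contra! hne
          exact hx (funext fun v => by simpa using hne v)
        simp only [hf, if_pos this, if_neg hx, sub_zero]
    rw [Finset.sum_congr rfl fun x _ => h1 x, Finset.sum_sub_distrib, sum_bernoulli_row]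
    simp
  have hterm : ∀ M : Fin n → Fin n → Fin m → Bool,
      (if NoEmptyShaft M then ∏ i, ∏ j, ∏ c, (if M i j c = true then p else 1 - p) else 0)
        = ∏ i, ∏ j, f (M i j) := by
    intro M
    split_ifs with h
    · exact Finset.prod_congr rfl fun i _ => Finset.prod_congr rfl fun j _ => by
        simp only [hf, if_pos (h i j)]
    · unfold NoEmptyShaft at h
      push Not at h
      obtain ⟨i, j, hij⟩ := h
      symm
      refine Finset.prod_eq_zero (Finset.mem_univ i) (Finset.prod_eq_zero (Finset.mem_univ j) ?_)
      simp only [hf]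
      rw [if_neg]
      push Not
      exact hij
  unfold arrProb
  rw [Finset.sum_congr rfl fun M _ => hterm M]
  have h2 := Finset.prod_univ_sum
    (fun _ : Fin n => (Finset.univ : Finset (Fin n → Fin m → Bool)))
    (fun _ y => ∏ j, f (y j))
  have h3 := Finset.prod_univ_sum (fun _ : Fin n => (Finset.univ : Finset (Fin m → Bool)))
    (fun _ x => f x)
  rw [Fintype.piFinset_univ] at h2 h3
  rw [← h2, ← h3, hsum]
  simp [pow_mul]

lemma procArr_mono {n m : ℕ} (σ : Fin (n * n * m) ≃ (Fin n × Fin n × Fin m)) {s t : ℕ}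
    (hst : s ≤ t) {r c : Fin n} {v : Fin m} (h : procArr n m σ s r c v = true) :
    procArr n m σ t r c v = true := by
  rw [procArr_eq_true] at h ⊢
  omega

lemma noEmptyShaft_hittingTime {n m : ℕ} [NeZero m]
    (σ : Fin (n * n * m) ≃ (Fin n × Fin n × Fin m)) :
    NoEmptyShaft (procArr n m σ (hittingTime n m σ NoEmptyShaft)) := by
  have hne : {t : ℕ | NoEmptyShaft (procArr n m σ t)}.Nonempty :=
    ⟨n * n * m, fun r c => ⟨0, (procArr_eq_true _ _ _ _ _).2 (Fin.isLt _)⟩⟩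
  exact Nat.sInf_mem hne

/-- If filling the empty shafts of the process at a time before all shafts are hit yields a
monotone property, then the property holds as soon as all shafts are hit. -/
lemma hittingTime_eq_of_fillArr {n m : ℕ} [NeZero m]
    (σ : Fin (n * n * m) ≃ (Fin n × Fin n × Fin m)) (t : ℕ)
    (Q : (Fin n → Fin n → Fin m → Bool) → Prop)
    (hmono : ∀ A B, (∀ r c v, A r c v = true → B r c v = true) → Q A → Q B)
    (hshaft : ∀ A, Q A → NoEmptyShaft A)
    (ht : ¬ NoEmptyShaft (procArr n m σ t))
    (hfill : Q (fillArr n m (procArr n m σ t) (firstPos σ))) :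
    hittingTime n m σ Q = hittingTime n m σ NoEmptyShaft := by
  set τ := hittingTime n m σ NoEmptyShaft with hτ
  have hnes : NoEmptyShaft (procArr n m σ τ) := noEmptyShaft_hittingTime σ
  have htτ : t ≤ τ := by
    by_contra! hlt
    refine ht fun r c => ?_
    obtain ⟨v, hv⟩ := hnes r c
    exact ⟨v, procArr_mono σ hlt.le hv⟩
  have hQτ : Q (procArr n m σ τ) := by
    refine hmono _ _ (fun r c v h => ?_) hfill
    simp only [fillArr, Bool.or_eq_true, Bool.and_eq_true, decide_eq_true_eq] at h
    rcases h with h | ⟨-, rfl⟩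
    · exact procArr_mono σ htτ h
    · obtain ⟨w, hw⟩ := hnes r c
      rw [procArr_eq_true] at hw ⊢
      exact lt_of_le_of_lt (firstPos_le σ r c w) hw
  refine le_antisymm (Nat.sInf_le hQτ) ?_
  exact Nat.sInf_le (hshaft _ (Nat.sInf_mem (s := {t | Q (procArr n m σ t)}) ⟨τ, hQτ⟩))

lemma gbProb_sub_arrProb_le {n m : ℕ} [NeZero m] {p : ℝ} (h0 : 0 ≤ p) (h1 : p ≤ 1)
    (Q : (Fin n → Fin n → Fin m → Bool) → Prop)
    (hmono : ∀ A B, (∀ r c v, A r c v = true → B r c v = true) → Q A → Q B)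
    (hshaft : ∀ A, Q A → NoEmptyShaft A) :
    gbProb n m p Q - arrProb n n m p NoEmptyShaft ≤
      ((Finset.univ.filter (fun σ : Fin (n * n * m) ≃ (Fin n × Fin n × Fin m) =>
        hittingTime n m σ Q = hittingTime n m σ NoEmptyShaft)).card : ℝ)
        / (Fintype.card (Fin (n * n * m) ≃ (Fin n × Fin n × Fin m)) : ℝ) := by
  have hcardpos : (0 : ℝ) < Fintype.card (Fin (n * n * m) ≃ (Fin n × Fin n × Fin m)) := by
    have : Nonempty (Fin (n * n * m) ≃ (Fin n × Fin n × Fin m)) :=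
      ⟨Fintype.equivOfCardEq (by simp [mul_assoc])⟩
    exact_mod_cast Fintype.card_pos
  have hm : (m : ℝ) ^ (n * n) ≠ 0 := pow_ne_zero _ (Nat.cast_ne_zero.2 (NeZero.ne m))
  set F : (Fin n → Fin n → Fin m → Bool) → (Fin n → Fin n → Fin m) → ℝ :=
    fun A g => if ¬ NoEmptyShaft A ∧ Q (fillArr n m A g) then 1 else 0 with hFdef
  have hF : ∀ A g g', (∀ r c, (∀ w, A r c w = false) → g r c = g' r c) → F A g = F A g' := by
    intro A g g' h
    have : fillArr n m A g = fillArr n m A g' := by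
      funext r c v
      unfold fillArr
      by_cases hs : ∀ w, A r c w = false
      · rw [h r c hs]
      · simp only [hs, decide_false, Bool.false_and]
    simp only [hFdef, this]
  have hmain := sum_binomialWeight_mul_sum_procArr p F hF
  rw [le_div_iff₀ hcardpos]
  calc (gbProb n m p Q - arrProb n n m p NoEmptyShaft)
        * Fintype.card (Fin (n * n * m) ≃ (Fin n × Fin n × Fin m))
      ≤ Fintype.card (Fin (n * n * m) ≃ (Fin n × Fin n × Fin m)) *
        ∑ A, ∑ g, F A g * (bernoulliWeight p A * (1 / (m : ℝ) ^ (n * n))) := by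
        rw [mul_comm]
        refine mul_le_mul_of_nonneg_left ?_ hcardpos.le
        have harr : arrProb n n m p NoEmptyShaft
            = ∑ A : Fin n → Fin n → Fin m → Bool, ∑ _g : Fin n → Fin n → Fin m,
              if NoEmptyShaft A then bernoulliWeight p A * (1 / (m : ℝ) ^ (n * n)) else 0 := by
          unfold arrProb
          refine Finset.sum_congr rfl fun A _ => ?_
          rw [Finset.sum_const]
          have hc : (Finset.univ : Finset (Fin n → Fin n → Fin m)).card = m ^ (n * n) := by
            simp [pow_mul]
          rw [hc, nsmul_eq_mul]
          split_ifs
          · unfold bernoulliWeight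
            push_cast
            field_simp
          · simp
        rw [harr, sub_le_iff_le_add, ← Finset.sum_add_distrib]
        unfold gbProb
        refine Finset.sum_le_sum fun A _ => ?_
        rw [← Finset.sum_add_distrib]
        refine Finset.sum_le_sum fun g _ => ?_
        have hnn : 0 ≤ bernoulliWeight p A * (1 / (m : ℝ) ^ (n * n)) :=
          mul_nonneg (bernoulliWeight_nonneg h0 h1 A) (by positivity)
        change (if Q (fillArr n m A g) then bernoulliWeight p A * (1 / (m : ℝ) ^ (n * n)) else 0)
          ≤ _
        by_cases hq : Q (fillArr n m A g) <;> by_cases hs : NoEmptyShaft A <;>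
          simp only [hFdef, hq, hs, if_true, if_false, not_true, not_false_eq_true, and_true,
            and_false, zero_mul, one_mul, zero_add, add_zero, le_refl, hnn]
    _ = ∑ t ∈ Finset.range (n * n * m + 1), binomialWeight (n * n * m) p t *
        ∑ σ : Fin (n * n * m) ≃ (Fin n × Fin n × Fin m),
          F (procArr n m σ t) (firstPos σ) := hmain.symm
    _ ≤ ∑ t ∈ Finset.range (n * n * m + 1), binomialWeight (n * n * m) p t *
        ((Finset.univ.filter (fun σ : Fin (n * n * m) ≃ (Fin n × Fin n × Fin m) =>
          hittingTime n m σ Q = hittingTime n m σ NoEmptyShaft)).card : ℝ) := by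
        refine Finset.sum_le_sum fun t _ =>
          mul_le_mul_of_nonneg_left ?_ (binomialWeight_nonneg _ h0 h1 t)
        rw [Finset.card_filter, Nat.cast_sum]
        refine Finset.sum_le_sum fun σ _ => ?_
        by_cases h : ¬ NoEmptyShaft (procArr n m σ t) ∧
            Q (fillArr n m (procArr n m σ t) (firstPos σ))
        · have he := hittingTime_eq_of_fillArr σ t Q hmono hshaft h.1 h.2
          simp only [hFdef, if_pos h, if_pos he, Nat.cast_one, le_refl]
        · simp only [hFdef, if_neg h]
          positivity
    _ = _ := by rw [← Finset.sum_mul, sum_binomialWeight, one_mul]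

lemma exp_neg_le_one_sub {p : ℝ} (h1 : p ≤ 1 / 2) :
    Real.exp (-(p + 2 * p ^ 2)) ≤ 1 - p := by
  have h2 : 1 ≤ (1 + (p + 2 * p ^ 2)) * (1 - p) := by
    nlinarith [mul_nonneg (sq_nonneg p) (sub_nonneg.2 h1)]
  have h3 := Real.add_one_le_exp (p + 2 * p ^ 2)
  rw [Real.exp_neg, inv_le_iff_one_le_mul₀ (Real.exp_pos _)]
  nlinarith

/-- The entry probability `(2/(1+ε))·(log n − log log n)/n`. -/
def entryProb (ε : ℝ) (n : ℕ) : ℝ :=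
  (2 / (1 + ε)) * (Real.log n - Real.log (Real.log n)) / n

lemma entryProb_mem {ε : ℝ} (hε : 0 < ε) {n : ℕ} (hL : 4 ≤ Real.log n)
    (hLn : Real.log n ^ 2 ≤ n) :
    0 ≤ entryProb ε n ∧ entryProb ε n ≤ 1 / 2 ∧ entryProb ε n ^ 2 * n ≤ 4 := by
  set L := Real.log n with hLdef
  have hn : (0 : ℝ) < n := by nlinarith
  have hlogL : 0 ≤ Real.log L := Real.log_nonneg (by linarith)
  have hlogL' : Real.log L ≤ L := Real.log_le_self (by linarith)
  have hc : 2 / (1 + ε) ≤ 2 := by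
    rw [div_le_iff₀ (by linarith)]; linarith
  have h0 : 0 ≤ entryProb ε n := by
    unfold entryProb
    have : 0 ≤ L - Real.log L := by linarith
    positivity
  have hle : entryProb ε n * n ≤ 2 * L := by
    unfold entryProb
    rw [div_mul_cancel₀ _ hn.ne']
    exact mul_le_mul hc (by linarith) (by linarith) (by norm_num)
  refine ⟨h0, ?_, ?_⟩
  · by_contra! h
    nlinarith
  · have h1 : (entryProb ε n * n) ^ 2 ≤ (2 * L) ^ 2 := by gcongr
    have h2 : entryProb ε n ^ 2 * n * n ≤ 4 * n := by nlinarith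
    exact le_of_mul_le_mul_right h2 hn

lemma arrProb_noEmptyShaft_le {ε : ℝ} (hε : 0 < ε) {n : ℕ} (hL : 4 ≤ Real.log n)
    (hLn : Real.log n ^ 2 ≤ n) :
    arrProb n n ⌈(1 + ε) * (n : ℝ)⌉₊ (entryProb ε n) NoEmptyShaft
      ≤ Real.exp (-(Real.log n ^ 2 * Real.exp (-(1 + 8 * (2 + ε))))) := by
  obtain ⟨h0, h1, h2⟩ := entryProb_mem hε hL hLn
  rw [arrProb_noEmptyShaft]
  have hmp : (1 + ε) * n * entryProb ε n = 2 * (Real.log n - Real.log (Real.log n)) := by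
    have hn : (n : ℝ) ≠ 0 := by nlinarith
    unfold entryProb
    field_simp
  set L := Real.log n with hLdef
  set p := entryProb ε n with hp
  set m := ⌈(1 + ε) * (n : ℝ)⌉₊ with hm
  have hn : (1 : ℝ) ≤ n := by nlinarith
  have hmle : (m : ℝ) ≤ (1 + ε) * n + 1 := (Nat.ceil_lt_add_one (by positivity)).le
  have hexponent : m * (p + 2 * p ^ 2)
      ≤ 2 * L - 2 * Real.log L + (1 + 8 * (2 + ε)) := by
    have ha : m * (p + 2 * p ^ 2) ≤ ((1 + ε) * n + 1) * (p + 2 * p ^ 2) := by gcongr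
    have hb : p ^ 2 ≤ p ^ 2 * n := le_mul_of_one_le_right (sq_nonneg p) hn
    have hc : (1 + ε) * (p ^ 2 * n) ≤ (1 + ε) * 4 := by gcongr
    nlinarith
  have hlow : Real.exp (-(2 * L - 2 * Real.log L + (1 + 8 * (2 + ε)))) ≤ (1 - p) ^ m := by
    calc _ ≤ Real.exp (-(p + 2 * p ^ 2)) ^ m := by
          rw [← Real.exp_nat_mul]
          exact Real.exp_le_exp.2 (by linarith)
      _ ≤ _ := by gcongr; exact exp_neg_le_one_sub h1
  have hsq : (n : ℝ) ^ 2 * Real.exp (-(2 * L - 2 * Real.log L + (1 + 8 * (2 + ε))))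
      = L ^ 2 * Real.exp (-(1 + 8 * (2 + ε))) := by
    have e1 : (n : ℝ) ^ 2 = Real.exp (2 * L) := by
      rw [hLdef, mul_comm, Real.exp_mul, Real.exp_log (by linarith)]
      norm_cast
    have e2 : L ^ 2 = Real.exp (2 * Real.log L) := by
      rw [mul_comm, Real.exp_mul, Real.exp_log (by linarith)]
      norm_cast
    rw [e1, e2, ← Real.exp_add, ← Real.exp_add]
    congr 1
    ring
  have hq1 : (1 - p) ^ m ≤ 1 := pow_le_one₀ (by linarith) (by linarith)
  calc (1 - (1 - p) ^ m) ^ (n * n)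
      ≤ Real.exp (-(1 - p) ^ m) ^ (n * n) := by
        gcongr
        linarith [Real.add_one_le_exp (-(1 - p) ^ m)]
    _ = Real.exp (-((n : ℝ) ^ 2 * (1 - p) ^ m)) := by
        rw [← Real.exp_nat_mul]
        push_cast
        congr 1
        ring
    _ ≤ _ := by
        rw [← hsq]
        gcongr

lemma eventually_log_bounds :
    ∀ᶠ n : ℕ in Filter.atTop, 4 ≤ Real.log n ∧ Real.log n ^ 2 ≤ n := by
  have h1 : Filter.Tendsto (fun n : ℕ => Real.log n) Filter.atTop Filter.atTop :=
    Real.tendsto_log_atTop.comp tendsto_natCast_atTop_atTop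
  have h2 := ((Real.isLittleO_pow_log_id_atTop (n := 2)).bound zero_lt_one).filter_mono
    (tendsto_natCast_atTop_atTop (R := ℝ))
  rw [Filter.eventually_map] at h2
  filter_upwards [h1.eventually_ge_atTop 4, h2] with n ha hb
  refine ⟨ha, ?_⟩
  simpa using hb

lemma tendsto_arrProb_noEmptyShaft {ε : ℝ} (hε : 0 < ε) :
    Filter.Tendsto (fun n : ℕ =>
      arrProb n n ⌈(1 + ε) * (n : ℝ)⌉₊ (entryProb ε n) NoEmptyShaft) Filter.atTop (nhds 0) := by
  have hlog : Filter.Tendsto (fun n : ℕ => Real.log n) Filter.atTop Filter.atTop :=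
    Real.tendsto_log_atTop.comp tendsto_natCast_atTop_atTop
  have hup : Filter.Tendsto (fun n : ℕ =>
      Real.exp (-(Real.log n ^ 2 * Real.exp (-(1 + 8 * (2 + ε)))))) Filter.atTop (nhds 0) :=
    Real.tendsto_exp_neg_atTop_nhds_zero.comp
      (((Filter.tendsto_pow_atTop two_ne_zero).comp hlog).atTop_mul_const (Real.exp_pos _))
  refine tendsto_of_tendsto_of_tendsto_of_le_of_le' tendsto_const_nhds hup ?_ ?_
  · filter_upwards [eventually_log_bounds] with n hn
    obtain ⟨h0, h1, -⟩ := entryProb_mem hε hn.1 hn.2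
    rw [arrProb_noEmptyShaft]
    have : (1 - entryProb ε n) ^ ⌈(1 + ε) * (n : ℝ)⌉₊ ≤ 1 :=
      pow_le_one₀ (by linarith) (by linarith)
    exact pow_nonneg (by linarith) _
  · filter_upwards [eventually_log_bounds] with n hn
    exact arrProb_noEmptyShaft_le hε hn.1 hn.2

/-- With `ε > 0`, `m = ⌈(1+ε)n⌉` and `p = (2/(1+ε))·(log n − log log n)/n`: if `Q` is a
monotone increasing property implying that there are no empty shafts, and `Q` holds
w.h.p. for `M ~ M≥1(n,n,m;p)`, then w.h.p. in the uniformly random `(n,n,m)`-array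
process the hitting time of `Q` equals the hitting time of having no empty shafts. -/
theorem stmt11 (ε : ℝ) (hε : 0 < ε)
    (Q : (n : ℕ) → (Fin n → Fin n → Fin ⌈(1 + ε) * (n : ℝ)⌉₊ → Bool) → Prop)
    (hmono : ∀ n A B, (∀ r c v, A r c v = true → B r c v = true) → Q n A → Q n B)
    (hshaft : ∀ n A, Q n A → NoEmptyShaft A)
    (hQ : Filter.Tendsto (fun n : ℕ =>
        gbProb n ⌈(1 + ε) * (n : ℝ)⌉₊
          ((2 / (1 + ε)) * (Real.log n - Real.log (Real.log n)) / n) (Q n))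
      Filter.atTop (nhds 1)) :
    Filter.Tendsto (fun n : ℕ =>
      ((Finset.univ.filter
          (fun σ : Fin (n * n * ⌈(1 + ε) * (n : ℝ)⌉₊) ≃
              (Fin n × Fin n × Fin ⌈(1 + ε) * (n : ℝ)⌉₊) =>
            hittingTime n ⌈(1 + ε) * (n : ℝ)⌉₊ σ (Q n)
              = hittingTime n ⌈(1 + ε) * (n : ℝ)⌉₊ σ NoEmptyShaft)).card : ℝ)
        / (Fintype.card (Fin (n * n * ⌈(1 + ε) * (n : ℝ)⌉₊) ≃
            (Fin n × Fin n × Fin ⌈(1 + ε) * (n : ℝ)⌉₊)) : ℝ))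
      Filter.atTop (nhds 1) := by
  have hlow := hQ.sub (tendsto_arrProb_noEmptyShaft hε)
  rw [sub_zero] at hlow
  refine tendsto_of_tendsto_of_tendsto_of_le_of_le' hlow tendsto_const_nhds ?_ ?_
  · filter_upwards [eventually_log_bounds] with n hn
    obtain ⟨h0, h1, -⟩ := entryProb_mem hε hn.1 hn.2
    have hnpos : (0 : ℝ) < n := by nlinarith
    have : NeZero ⌈(1 + ε) * (n : ℝ)⌉₊ := ⟨(Nat.ceil_pos.2 (by positivity)).ne'⟩
    exact gbProb_sub_arrProb_le h0 (by linarith) (Q n) (hmono n) (hshaft n)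
  · refine Filter.Eventually.of_forall fun n => ?_
    refine div_le_one_of_le₀ ?_ (Nat.cast_nonneg _)
    exact_mod_cast Finset.card_le_univ _

end
end

section
/- Fix ε > 0, set m = ⌈(1+ε)n⌉ and p = (2/(1+ε))·(log n − log log n)/n, and let M ~ M≥1(n,n,m;p). Then for every γ > 0, with probability tending to 1 as n → ∞, M supports a partial Latin box B₂ that covers at most γn positions in each row and in each column, and such that every position (r,c) not covered by B₂ satisfies d_m(r,c) ≥ (ε/(1+ε))·log n, where d_m(r,c) = Σ_{i=n+1}^{m} M(r,c,i). -/
attribute [local instance] Classical.propDecidable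

noncomputable section

/-- A partial Latin box on `[n]²` with values in `[m]`, encoded with `Option`: positions
mapped to `some v` are covered; two positions agreeing in exactly one coordinate must
receive distinct values. -/
def IsPartialLatinBox {n m : ℕ} (B : Fin n → Fin n → Option (Fin m)) : Prop :=
  (∀ r c c' v, c ≠ c' → B r c = some v → B r c' ≠ some v) ∧
  (∀ r r' c v, r ≠ r' → B r c = some v → B r' c ≠ some v)

/-- The partial Latin box `B` is supported by the array `M`. -/
def SupportsPartial {n m : ℕ} (M : Fin n → Fin n → Fin m → Bool)
    (B : Fin n → Fin n → Option (Fin m)) : Prop :=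
  ∀ r c v, B r c = some v → M r c v = true

/-- The expectation of `F` over independent coordinates of common weight function `w`. -/
def prodExp {ι Ω : Type} [Fintype ι] [DecidableEq ι] [Fintype Ω] (w : Ω → ℝ) (F : (ι → Ω) → ℝ) : ℝ :=
  ∑ ω : ι → Ω, (∏ i, w (ω i)) * F ω

lemma prod_update_mul {ι Ω : Type} [Fintype ι] [DecidableEq ι] (w : Ω → ℝ) (ω : ι → Ω) (i : ι) (x : Ω) :
    (∏ j, w (Function.update ω i x j)) * w (ω i) = (∏ j, w (ω j)) * w x := by
  rw [← Finset.mul_prod_erase _ _ (Finset.mem_univ i),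
    ← Finset.mul_prod_erase _ (fun j => w (ω j)) (Finset.mem_univ i)]
  have : ∏ j ∈ Finset.univ.erase i, w (Function.update ω i x j)
      = ∏ j ∈ Finset.univ.erase i, w (ω j) :=
    Finset.prod_congr rfl fun j hj => by
      rw [Function.update_of_ne (Finset.ne_of_mem_erase hj)]
  rw [this, Function.update_self]
  ring

section prodExp

variable {ι Ω : Type} [Fintype ι] [DecidableEq ι] [Fintype Ω] {w : Ω → ℝ}

lemma prodExp_prod (w : Ω → ℝ) (h : ι → Ω → ℝ) :
    prodExp w (fun ω : ι → Ω => ∏ i, h i (ω i)) = ∏ i, ∑ x, w x * h i x := by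
  simp only [prodExp, ← Finset.prod_mul_distrib]
  rw [Finset.prod_univ_sum]
  simp

lemma prodExp_const (hw : ∑ x, w x = 1) (t : ℝ) : prodExp w (fun _ : ι → Ω => t) = t := by
  have h := prodExp_prod (ι := ι) w (fun _ _ => 1)
  simp only [prodExp, Finset.prod_const_one, mul_one, hw] at h
  rw [prodExp, ← Finset.sum_mul, h, one_mul]

lemma prodExp_mono (hw : ∀ x, 0 ≤ w x) {F G : (ι → Ω) → ℝ} (h : ∀ ω, F ω ≤ G ω) :
    prodExp w F ≤ prodExp w G :=
  Finset.sum_le_sum fun ω _ =>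
    mul_le_mul_of_nonneg_left (h ω) (Finset.prod_nonneg fun i _ => hw (ω i))

lemma prodExp_add (w : Ω → ℝ) (F G : (ι → Ω) → ℝ) :
    prodExp w (fun ω => F ω + G ω) = prodExp w F + prodExp w G := by
  simp only [prodExp, mul_add, Finset.sum_add_distrib]

lemma prodExp_sub (w : Ω → ℝ) (F G : (ι → Ω) → ℝ) :
    prodExp w (fun ω => F ω - G ω) = prodExp w F - prodExp w G := by
  simp only [prodExp, mul_sub, Finset.sum_sub_distrib]

lemma prodExp_const_mul (w : Ω → ℝ) (t : ℝ) (F : (ι → Ω) → ℝ) :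
    prodExp w (fun ω => t * F ω) = t * prodExp w F := by
  simp only [prodExp, Finset.mul_sum]
  exact Finset.sum_congr rfl fun _ _ => by ring

lemma prodExp_sum {κ : Type} (w : Ω → ℝ) (s : Finset κ) (F : κ → (ι → Ω) → ℝ) :
    prodExp w (fun ω => ∑ k ∈ s, F k ω) = ∑ k ∈ s, prodExp w (F k) := by
  simp only [prodExp, Finset.mul_sum]
  exact Finset.sum_comm

/-- Resampling one coordinate does not change the expectation. -/
lemma prodExp_resample (hw : ∑ x, w x = 1) (i : ι) (F : (ι → Ω) → ℝ) :
    prodExp w F = prodExp w (fun ω => ∑ x, w x * F (Function.update ω i x)) := by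
  have key : ∑ y : (ι → Ω) × Ω, (∏ j, w (y.1 j)) * w y.2 * F y.1
      = ∑ y : (ι → Ω) × Ω, (∏ j, w (y.1 j)) * w y.2 * F (Function.update y.1 i y.2) := by
    refine Finset.sum_bij' (fun y _ => (Function.update y.1 i y.2, y.1 i))
      (fun y _ => (Function.update y.1 i y.2, y.1 i)) ?_ ?_ ?_ ?_ ?_
    · simp
    · simp
    · rintro ⟨ω, x⟩ -; simp
    · rintro ⟨ω, x⟩ -; simp
    · rintro ⟨ω, x⟩ -
      simp [prod_update_mul]
  rw [Fintype.sum_prod_type, Fintype.sum_prod_type] at key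
  calc prodExp w F = ∑ ω : ι → Ω, ∑ x, (∏ j, w (ω j)) * w x * F ω := by
        refine Finset.sum_congr rfl fun ω _ => ?_
        rw [← Finset.sum_mul, ← Finset.mul_sum, hw, mul_one]
    _ = _ := by
        rw [key]
        refine Finset.sum_congr rfl fun ω _ => ?_
        rw [Finset.mul_sum]
        exact Finset.sum_congr rfl fun x _ => by ring

end prodExp

/-- The randomness of one shaft: the initial entries and the position used if they all vanish. -/
abbrev Shaft (m : ℕ) : Type := (Fin m → Bool) × Fin m

/-- The probability weight of the initial entries of a shaft. -/
def entryWt {m : ℕ} (p : ℝ) (a : Fin m → Bool) : ℝ := ∏ v, if a v = true then p else 1 - p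

/-- The probability weight of a shaft. -/
def shaftWt {m : ℕ} (p : ℝ) (x : Shaft m) : ℝ := entryWt p x.1 * (1 / (m : ℝ))

/-- The shaft after the filling step. -/
def filled {m : ℕ} (x : Shaft m) (v : Fin m) : Bool :=
  x.1 v || (decide (∀ u, x.1 u = false) && decide (x.2 = v))

lemma gbProb_eq_prodExp (n m : ℕ) (p : ℝ) (P : (Fin n → Fin n → Fin m → Bool) → Prop) :
    gbProb n m p P = prodExp (shaftWt p) (fun ω : Fin n × Fin n → Shaft m =>
      if P (fun r c => filled (ω (r, c))) then 1 else 0) := by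
  rw [gbProb, ← Fintype.sum_prod_type', prodExp]
  refine Finset.sum_bij' (fun y _ x => (y.1 x.1 x.2, y.2 x.1 x.2))
    (fun ω _ => (fun r c => (ω (r, c)).1, fun r c => (ω (r, c)).2))
    (fun _ _ => Finset.mem_univ _) (fun _ _ => Finset.mem_univ _)
    (fun _ _ => rfl) (fun _ _ => rfl) ?_
  · rintro ⟨A, g⟩ -
    have h1 : ∏ x : Fin n × Fin n, shaftWt p (A x.1 x.2, g x.1 x.2)
        = (∏ r, ∏ c, ∏ v, if A r c v = true then p else 1 - p) * (1 / (m : ℝ) ^ (n * n)) := by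
      simp only [shaftWt, Finset.prod_mul_distrib, Finset.prod_const, entryWt]
      rw [Fintype.prod_prod_type]
      simp
    simp only [h1, mul_ite, mul_one, mul_zero]
    rfl

section Shaft

variable {m : ℕ} {p : ℝ}

lemma entryWt_nonneg (h0 : 0 ≤ p) (h1 : p ≤ 1) (a : Fin m → Bool) : 0 ≤ entryWt p a :=
  Finset.prod_nonneg fun v _ => by split_ifs <;> linarith

lemma shaftWt_nonneg (h0 : 0 ≤ p) (h1 : p ≤ 1) (x : Shaft m) : 0 ≤ shaftWt p x :=
  mul_nonneg (entryWt_nonneg h0 h1 _) (by positivity)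

lemma sum_entryWt_mul_prod (p : ℝ) (h : Fin m → Bool → ℝ) :
    ∑ a : Fin m → Bool, entryWt p a * ∏ v, h v (a v)
      = ∏ v, (p * h v true + (1 - p) * h v false) := by
  have := prodExp_prod (ι := Fin m) (fun b : Bool => if b = true then p else 1 - p) h
  simpa [prodExp, entryWt] using this

lemma sum_entryWt (p : ℝ) : ∑ a : Fin m → Bool, entryWt p a = 1 := by
  simpa using sum_entryWt_mul_prod (m := m) p (fun _ _ => 1)

lemma sum_shaftWt_mul_entries (hm : 0 < m) (p : ℝ) (f : (Fin m → Bool) → ℝ) :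
    ∑ x : Shaft m, shaftWt p x * f x.1 = ∑ a, entryWt p a * f a := by
  rw [Fintype.sum_prod_type]
  refine Finset.sum_congr rfl fun a _ => ?_
  have : (m : ℝ) ≠ 0 := by positivity
  simp [shaftWt]
  field_simp

lemma sum_shaftWt (hm : 0 < m) (p : ℝ) : ∑ x : Shaft m, shaftWt p x = 1 := by
  simpa [sum_entryWt] using sum_shaftWt_mul_entries hm p (fun _ => 1)

lemma sum_entryWt_subset (hp : p < 1) (V : Finset (Fin m)) :
    ∑ a : Fin m → Bool, entryWt p a * (if ∀ v, a v = true → v ∈ V then 1 else 0)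
      = (1 - p) ^ m * ((1 - p)⁻¹) ^ V.card := by
  have hne : 1 - p ≠ 0 := by linarith
  have h1 : ∀ a : Fin m → Bool, (if ∀ v, a v = true → v ∈ V then (1 : ℝ) else 0)
      = ∏ v, (if a v = true → v ∈ V then (1 : ℝ) else 0) := by
    intro a
    rw [Finset.prod_ite_zero]
    simp
  simp only [h1]
  rw [sum_entryWt_mul_prod p (fun v b => if b = true → v ∈ V then (1 : ℝ) else 0)]
  have h2 : ∀ v : Fin m, (p * (if true = true → v ∈ V then (1 : ℝ) else 0)
      + (1 - p) * (if false = true → v ∈ V then (1 : ℝ) else 0))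
      = (1 - p) * (if v ∈ V then (1 - p)⁻¹ else 1) := by
    intro v
    by_cases hv : v ∈ V <;> simp [hv, hne]
  rw [Finset.prod_congr rfl fun v _ => h2 v, Finset.prod_mul_distrib, Finset.prod_ite]
  simp

lemma mul_le_inv_pow_sub_one (h0 : 0 ≤ p) (hp : p < 1) (k : ℕ) :
    k * p ≤ ((1 - p)⁻¹) ^ k - 1 := by
  have h1 : 0 < 1 - p := by linarith
  have h2 : 1 + p ≤ (1 - p)⁻¹ := by
    rw [le_inv_comm₀ (by linarith) h1, inv_eq_one_div, le_div_iff₀ (by linarith)]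
    nlinarith
  have h3 := one_add_mul_le_pow (show (-2 : ℝ) ≤ p by linarith) k
  have h4 : (1 + p) ^ k ≤ ((1 - p)⁻¹) ^ k := pow_le_pow_left₀ (by linarith) h2 k
  linarith

/-- The probability that all ones of a filled shaft lie in a given set of symbols. -/
lemma sum_shaftWt_filled_subset (hm : 0 < m) (h0 : 0 ≤ p) (hp : p < 1) (hpm : 1 ≤ p * m)
    (V : Finset (Fin m)) :
    ∑ x : Shaft m, shaftWt p x * (if ∀ v, filled x v = true → v ∈ V then 1 else 0)
      ≤ 2 * (1 - p) ^ m * (((1 - p)⁻¹) ^ V.card - 1) := by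
  have hm' : (0 : ℝ) < m := by positivity
  have hb : ∀ x : Shaft m, (if ∀ v, filled x v = true → v ∈ V then (1 : ℝ) else 0)
      ≤ (if ∀ v, x.1 v = true → v ∈ V then 1 else 0)
        - (if ∀ v, x.1 v = true → v ∈ (∅ : Finset (Fin m)) then 1 else 0)
        + (if ∀ v, x.1 v = true → v ∈ (∅ : Finset (Fin m)) then 1 else 0)
          * (if x.2 ∈ V then 1 else 0) := by
    intro x
    by_cases he : ∀ v, x.1 v = true → v ∈ (∅ : Finset (Fin m))
    · have he' : ∀ v, x.1 v = false := fun v => by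
        by_contra hv
        exact absurd (he v (by simpa using hv)) (by simp)
      by_cases hx : x.2 ∈ V
      · rw [if_pos fun v hv => absurd (he v hv) (by simp), if_pos he, if_pos hx]
        split_ifs <;> norm_num
      · have : ¬ ∀ v, filled x v = true → v ∈ V := fun h =>
          hx (h x.2 (by simp [filled, he']))
        simp [this, he', hx]
    · have he' : ¬ ∀ u, x.1 u = false := fun h => he fun v hv => by simp [h v] at hv
      have : ∀ v, filled x v = x.1 v := fun v => by simp [filled, he']
      simp only [this, he, if_false]
      simp
  have hlast : ∑ x : Shaft m, shaftWt p x *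
      ((if ∀ v, x.1 v = true → v ∈ (∅ : Finset (Fin m)) then (1 : ℝ) else 0)
          * (if x.2 ∈ V then 1 else 0)) = (1 - p) ^ m * (V.card / m) := by
    have := sum_entryWt_subset (m := m) hp ∅
    simp only [Finset.card_empty, pow_zero, mul_one] at this
    rw [Fintype.sum_prod_type, ← this, Finset.sum_mul]
    refine Finset.sum_congr rfl fun a _ => ?_
    by_cases he : ∀ v, a v = true → v ∈ (∅ : Finset (Fin m))
    · simp only [shaftWt, if_pos he, one_mul, ← Finset.mul_sum]
      simp
      field_simp
    · simp only [if_neg he]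
      simp
  calc _ ≤ ∑ x : Shaft m, (shaftWt p x * (if ∀ v, x.1 v = true → v ∈ V then 1 else 0)
        - shaftWt p x * (if ∀ v, x.1 v = true → v ∈ (∅ : Finset (Fin m)) then 1 else 0)
        + shaftWt p x * ((if ∀ v, x.1 v = true → v ∈ (∅ : Finset (Fin m)) then 1 else 0)
          * (if x.2 ∈ V then 1 else 0))) := by
        refine Finset.sum_le_sum fun x _ => ?_
        rw [← mul_sub, ← mul_add]
        exact mul_le_mul_of_nonneg_left (hb x) (shaftWt_nonneg h0 hp.le x)
    _ = (1 - p) ^ m * (((1 - p)⁻¹) ^ V.card - 1) + (1 - p) ^ m * (V.card / m) := by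
        rw [Finset.sum_add_distrib, Finset.sum_sub_distrib, hlast,
          sum_shaftWt_mul_entries hm p (fun a => if ∀ v, a v = true → v ∈ V then 1 else 0),
          sum_shaftWt_mul_entries hm p
            (fun a => if ∀ v, a v = true → v ∈ (∅ : Finset (Fin m)) then 1 else 0),
          sum_entryWt_subset hp, sum_entryWt_subset hp]
        simp
        ring
    _ ≤ _ := by
        have h1 : (V.card : ℝ) / m ≤ V.card * p := by
          rw [div_le_iff₀ hm']
          have : (0 : ℝ) ≤ V.card := by positivity
          nlinarith
        have h2 := mul_le_inv_pow_sub_one h0 hp V.card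
        have h3 : 0 ≤ (1 - p) ^ m := pow_nonneg (by linarith) m
        nlinarith

end Shaft

/-- The number of ones of a shaft before the filling step. -/
def numEntries {m : ℕ} (a : Fin m → Bool) : ℕ := (Finset.univ.filter fun v => a v = true).card

lemma card_filled_le {m : ℕ} (x : Shaft m) :
    (Finset.univ.filter fun v => filled x v = true).card ≤ numEntries x.1 + 1 := by
  have : (Finset.univ.filter fun v => filled x v = true)
      ⊆ (Finset.univ.filter fun v => x.1 v = true) ∪ {x.2} := by
    intro v
    simp only [filled, Finset.mem_filter, Finset.mem_univ, true_and, Finset.mem_union,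
      Finset.mem_singleton, Bool.or_eq_true, Bool.and_eq_true, decide_eq_true_eq]
    rintro (h | ⟨-, h⟩)
    · exact Or.inl h
    · exact Or.inr h.symm
  exact (Finset.card_le_card this).trans (Finset.card_union_le _ _)

/-- The positions other than `i` that share a row or a column with `i`. -/
def neighbours {n : ℕ} (i : Fin n × Fin n) : Finset (Fin n × Fin n) :=
  Finset.univ.filter fun j => j ≠ i ∧ (j.1 = i.1 ∨ j.2 = i.2)

lemma card_neighbours_le {n : ℕ} (i : Fin n × Fin n) : (neighbours i).card ≤ 2 * n := by
  have : neighbours i ⊆ (Finset.univ.image fun c : Fin n => (i.1, c))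
      ∪ Finset.univ.image fun r : Fin n => (r, i.2) := by
    rintro ⟨r, c⟩
    simp only [neighbours, Finset.mem_filter, Finset.mem_univ, true_and, Finset.mem_union,
      Finset.mem_image]
    rintro ⟨-, h | h⟩
    · exact Or.inl ⟨c, by simp_all⟩
    · exact Or.inr ⟨r, by simp_all⟩
  have h1 := Finset.card_le_card this
  have h2 := Finset.card_union_le (Finset.univ.image fun c : Fin n => (i.1, c))
    (Finset.univ.image fun r : Fin n => (r, i.2))
  have h3 := Finset.card_image_le (s := Finset.univ) (f := fun c : Fin n => (i.1, c))
  have h4 := Finset.card_image_le (s := Finset.univ) (f := fun r : Fin n => (r, i.2))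
  simp only [Finset.card_univ, Fintype.card_fin] at h3 h4
  omega

section Bounds

variable {n m : ℕ} {p : ℝ} (bad : (Fin m → Bool) → Prop)

/-- The symbols appearing in a filled bad shaft sharing a row or a column with `i`. -/
def clashes (ω : Fin n × Fin n → Shaft m) (i : Fin n × Fin n) : Finset (Fin m) :=
  Finset.univ.filter fun v => ∃ j ∈ neighbours i, bad (ω j).1 ∧ filled (ω j) v = true

/-- An upper bound for the number of symbols for which a bad shaft causes a conflict. -/
def badSize (a : Fin m → Bool) : ℕ := if bad a then numEntries a + 1 else 0

lemma card_clashes_le (ω : Fin n × Fin n → Shaft m) (i : Fin n × Fin n) :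
    (clashes bad ω i).card ≤ ∑ j ∈ neighbours i, badSize bad (ω j).1 := by
  have : clashes bad ω i ⊆ (neighbours i).biUnion fun j =>
      if bad (ω j).1 then Finset.univ.filter fun v => filled (ω j) v = true else ∅ := by
    intro v
    simp only [clashes, Finset.mem_filter, Finset.mem_univ, true_and, Finset.mem_biUnion]
    rintro ⟨j, hj, hb, hv⟩
    exact ⟨j, hj, by simp [hb, hv]⟩
  refine (Finset.card_le_card this).trans (Finset.card_biUnion_le.trans ?_)
  refine Finset.sum_le_sum fun j _ => ?_
  by_cases hb : bad (ω j).1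
  · simpa [hb, badSize] using card_filled_le (ω j)
  · simp [hb, badSize]

lemma clashes_update (ω : Fin n × Fin n → Shaft m) (i : Fin n × Fin n) (x : Shaft m) :
    clashes bad (Function.update ω i x) i = clashes bad ω i := by
  ext v
  simp only [clashes, Finset.mem_filter, Finset.mem_univ, true_and]
  refine exists_congr fun j => and_congr_right fun hj => ?_
  have : j ≠ i := (Finset.mem_filter.1 hj).2.1
  rw [Function.update_of_ne this]

/-- A bound for the probability that every one of the shaft at `i` is in conflict with some
bad shaft. -/
lemma prodExp_blocked_le (hm : 0 < m) (h0 : 0 ≤ p) (hp : p < 1) (hpm : 1 ≤ p * m) {β : ℝ}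
    (hβ0 : 0 ≤ β) (hβ : ∑ a : Fin m → Bool, entryWt p a * ((1 - p)⁻¹) ^ badSize bad a ≤ 1 + β)
    (i : Fin n × Fin n) :
    prodExp (shaftWt p) (fun ω : Fin n × Fin n → Shaft m =>
      if ∀ v, filled (ω i) v = true → v ∈ clashes bad ω i then 1 else 0)
      ≤ 2 * (1 - p) ^ m * ((1 + β) ^ (2 * n) - 1) := by
  have hq : 0 ≤ (1 - p) ^ m := pow_nonneg (by linarith) m
  have hone : 1 ≤ (1 - p)⁻¹ := (one_le_inv₀ (by linarith)).2 (by linarith)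
  have hw := sum_shaftWt hm p
  have hnn : ∀ x : Shaft m, 0 ≤ shaftWt p x := shaftWt_nonneg h0 hp.le
  let h : Fin n × Fin n → Shaft m → ℝ := fun j x =>
    if j ∈ neighbours i then ((1 - p)⁻¹) ^ badSize bad x.1 else 1
  have hprod : ∀ ω : Fin n × Fin n → Shaft m,
      ((1 - p)⁻¹) ^ (clashes bad ω i).card ≤ ∏ j, h j (ω j) := by
    intro ω
    rw [Finset.prod_ite_mem, Finset.univ_inter, Finset.prod_pow_eq_pow_sum]
    exact pow_le_pow_right₀ hone (card_clashes_le bad ω i)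
  have hexp : ∏ j, ∑ x, shaftWt p x * h j x ≤ (1 + β) ^ (2 * n) := by
    calc ∏ j, ∑ x, shaftWt p x * h j x
        ≤ ∏ j : Fin n × Fin n, (if j ∈ neighbours i then 1 + β else 1) := by
          refine Finset.prod_le_prod (fun j _ => Finset.sum_nonneg fun x _ =>
            mul_nonneg (hnn x) ?_) fun j _ => ?_
          · simp only [h]
            split_ifs
            · positivity
            · norm_num
          · by_cases hj : j ∈ neighbours i
            · simp only [h, hj, if_true]
              rw [sum_shaftWt_mul_entries hm p fun a => ((1 - p)⁻¹) ^ badSize bad a]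
              exact hβ
            · simp only [h, hj, if_false, mul_one]
              exact hw.le
      _ = (1 + β) ^ (neighbours i).card := by
          rw [Finset.prod_ite_mem, Finset.univ_inter, Finset.prod_const]
      _ ≤ _ := pow_le_pow_right₀ (by linarith) (card_neighbours_le i)
  rw [prodExp_resample hw i]
  calc _ ≤ prodExp (shaftWt p) (fun ω : Fin n × Fin n → Shaft m =>
        2 * (1 - p) ^ m * (∏ j, h j (ω j) - 1)) := by
        refine prodExp_mono hnn fun ω => ?_
        simp only [clashes_update, Function.update_self]
        refine (sum_shaftWt_filled_subset hm h0 hp hpm _).trans ?_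
        have := hprod ω
        gcongr
    _ = 2 * (1 - p) ^ m * (∏ j, ∑ x, shaftWt p x * h j x - 1) := by
        rw [prodExp_const_mul, prodExp_sub, prodExp_prod, prodExp_const hw]
    _ ≤ _ := by gcongr

/-- A Chernoff bound for the number of bad shafts in a set `T` of positions. -/
lemma prodExp_manyBad_le (hm : 0 < m) (h0 : 0 ≤ p) (hp : p < 1) {q : ℝ} (hq0 : 0 ≤ q)
    (hq : ∑ a : Fin m → Bool, entryWt p a * (if bad a then 1 else 0) ≤ q) (t : ℝ)
    (T : Finset (Fin n × Fin n)) (hT : T.card = n) :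
    prodExp (shaftWt p) (fun ω : Fin n × Fin n → Shaft m =>
      if t < (T.filter fun j => bad (ω j).1).card then 1 else 0)
      ≤ Real.exp (-t) * (1 + 2 * q) ^ n := by
  have hw := sum_shaftWt hm p
  have hnn : ∀ x : Shaft m, 0 ≤ shaftWt p x := shaftWt_nonneg h0 hp.le
  let h : Fin n × Fin n → Shaft m → ℝ := fun j x =>
    if j ∈ T then (if bad x.1 then Real.exp 1 else 1) else 1
  have hprod : ∀ ω : Fin n × Fin n → Shaft m,
      ∏ j, h j (ω j) = Real.exp ((T.filter fun j => bad (ω j).1).card : ℝ) := by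
    intro ω
    rw [Finset.prod_ite_mem, Finset.univ_inter, ← Finset.prod_filter, Finset.prod_const,
      ← Real.exp_nat_mul, mul_one]
  have hexp : ∏ j, ∑ x, shaftWt p x * h j x ≤ (1 + 2 * q) ^ n := by
    calc ∏ j, ∑ x, shaftWt p x * h j x
        ≤ ∏ j : Fin n × Fin n, (if j ∈ T then 1 + 2 * q else 1) := by
          refine Finset.prod_le_prod (fun j _ => Finset.sum_nonneg fun x _ =>
            mul_nonneg (hnn x) ?_) fun j _ => ?_
          · simp only [h]
            split_ifs <;> positivity
          · by_cases hj : j ∈ T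
            · simp only [h, hj, if_true]
              have he : ∀ a : Fin m → Bool, (if bad a then Real.exp 1 else 1)
                  = 1 + (Real.exp 1 - 1) * (if bad a then (1 : ℝ) else 0) := by
                intro a
                split_ifs <;> ring
              rw [sum_shaftWt_mul_entries hm p fun a => if bad a then Real.exp 1 else 1]
              simp only [he, mul_add, mul_one, Finset.sum_add_distrib, sum_entryWt]
              have : ∑ a : Fin m → Bool, entryWt p a * ((Real.exp 1 - 1) * (if bad a then 1 else 0))
                  = (Real.exp 1 - 1) * ∑ a : Fin m → Bool, entryWt p a * (if bad a then 1 else 0) := by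
                rw [Finset.mul_sum]
                exact Finset.sum_congr rfl fun _ _ => by ring
              rw [this]
              have h1 := Real.exp_one_lt_d9
              have h2 := Real.add_one_le_exp (1 : ℝ)
              have : (Real.exp 1 - 1) * ∑ a : Fin m → Bool, entryWt p a * (if bad a then 1 else 0)
                  ≤ (Real.exp 1 - 1) * q := mul_le_mul_of_nonneg_left hq (by linarith)
              nlinarith
            · simp only [h, hj, if_false, mul_one]
              exact hw.le
      _ = _ := by
          rw [Finset.prod_ite_mem, Finset.univ_inter, Finset.prod_const, hT]
  calc _ ≤ prodExp (shaftWt p) (fun ω : Fin n × Fin n → Shaft m =>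
        Real.exp (-t) * ∏ j, h j (ω j)) := by
        refine prodExp_mono hnn fun ω => ?_
        rw [hprod, ← Real.exp_add]
        split_ifs with ht
        · exact Real.one_le_exp (by linarith)
        · positivity
    _ = Real.exp (-t) * ∏ j, ∑ x, shaftWt p x * h j x := by
        rw [prodExp_const_mul, prodExp_prod]
    _ ≤ _ := by gcongr

lemma card_row (r : Fin n) :
    (Finset.univ.filter fun j : Fin n × Fin n => j.1 = r).card = n := by
  have : (Finset.univ.filter fun j : Fin n × Fin n => j.1 = r)
      = Finset.univ.image fun c : Fin n => (r, c) := by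
    ext ⟨a, b⟩
    simp [eq_comm]
  rw [this, Finset.card_image_of_injective _ (Prod.mk_right_injective r), Finset.card_fin]

lemma card_col (c : Fin n) :
    (Finset.univ.filter fun j : Fin n × Fin n => j.2 = c).card = n := by
  have : (Finset.univ.filter fun j : Fin n × Fin n => j.2 = c)
      = Finset.univ.image fun r : Fin n => (r, c) := by
    ext ⟨a, b⟩
    simp [eq_comm]
  rw [this, Finset.card_image_of_injective _ (Prod.mk_left_injective c), Finset.card_fin]

/-- If no position is blocked and few shafts are bad in each row and column, then the bad
positions can be covered by a partial Latin box. -/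
lemma exists_partialLatinBox (ω : Fin n × Fin n → Shaft m) (t : ℝ)
    (hblock : ∀ i, ¬ ∀ v, filled (ω i) v = true → v ∈ clashes bad ω i)
    (hrow : ∀ r, (((Finset.univ.filter fun j : Fin n × Fin n => j.1 = r).filter
      fun j => bad (ω j).1).card : ℝ) ≤ t)
    (hcol : ∀ c, (((Finset.univ.filter fun j : Fin n × Fin n => j.2 = c).filter
      fun j => bad (ω j).1).card : ℝ) ≤ t) :
    ∃ B : Fin n → Fin n → Option (Fin m),
      IsPartialLatinBox B ∧ SupportsPartial (fun r c => filled (ω (r, c))) B ∧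
      (∀ r, ((Finset.univ.filter (fun c => B r c ≠ none)).card : ℝ) ≤ t) ∧
      (∀ c, ((Finset.univ.filter (fun r => B r c ≠ none)).card : ℝ) ≤ t) ∧
      (∀ r c, B r c = none → ¬ bad (ω (r, c)).1) := by
  push Not at hblock
  choose f hf hfc using hblock
  have hclash : ∀ i j, j ∈ neighbours i → bad (ω j).1 → f j ≠ f i := by
    intro i j hj hb he
    refine hfc i (Finset.mem_filter.2 ⟨Finset.mem_univ _, j, hj, hb, ?_⟩)
    rw [← he]
    exact hf j
  have hB : ∀ r c v, (if bad (ω (r, c)).1 then some (f (r, c)) else none) = some v →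
      bad (ω (r, c)).1 ∧ f (r, c) = v := by
    intro r c v h
    split_ifs at h with hb
    exact ⟨hb, Option.some.inj h⟩
  refine ⟨fun r c => if bad (ω (r, c)).1 then some (f (r, c)) else none, ⟨?_, ?_⟩, ?_, ?_, ?_, ?_⟩
  · intro r c c' v hc h1 h2
    obtain ⟨-, e1⟩ := hB _ _ _ h1
    obtain ⟨b2, e2⟩ := hB _ _ _ h2
    refine hclash (r, c) (r, c') ?_ b2 (e2.trans e1.symm)
    simp [neighbours, hc.symm]
  · intro r r' c v hr h1 h2
    obtain ⟨-, e1⟩ := hB _ _ _ h1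
    obtain ⟨b2, e2⟩ := hB _ _ _ h2
    refine hclash (r, c) (r', c) ?_ b2 (e2.trans e1.symm)
    simp [neighbours, hr.symm]
  · intro r c v h
    obtain ⟨-, rfl⟩ := hB _ _ _ h
    exact hf _
  · intro r
    refine le_trans (Nat.cast_le.2 ?_) (hrow r)
    refine Finset.card_le_card_of_injOn (fun c => (r, c)) ?_ fun _ _ _ _ h => (Prod.ext_iff.1 h).2
    intro c hc
    simpa using hc
  · intro c
    refine le_trans (Nat.cast_le.2 ?_) (hcol c)
    refine Finset.card_le_card_of_injOn (fun r => (r, c)) ?_ fun _ _ _ _ h => (Prod.ext_iff.1 h).1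
    intro r hr
    simpa using hr
  · intro r c h
    simpa using h

lemma gbProb_le_one (hm : 0 < m) (h0 : 0 ≤ p) (hp : p < 1)
    (P : (Fin n → Fin n → Fin m → Bool) → Prop) : gbProb n m p P ≤ 1 := by
  rw [gbProb_eq_prodExp]
  refine (prodExp_mono (G := fun _ => 1) (shaftWt_nonneg h0 hp.le) fun ω => ?_).trans
    (prodExp_const (sum_shaftWt hm p) 1).le
  split_ifs <;> norm_num

/-- The union bound for the existence of a partial Latin box covering all bad positions. -/
lemma le_gbProb (hm : 0 < m) (h0 : 0 ≤ p) (hp : p < 1) (hpm : 1 ≤ p * m) {β q : ℝ}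
    (hβ0 : 0 ≤ β) (hβ : ∑ a : Fin m → Bool, entryWt p a * ((1 - p)⁻¹) ^ badSize bad a ≤ 1 + β)
    (hq0 : 0 ≤ q) (hq : ∑ a : Fin m → Bool, entryWt p a * (if bad a then 1 else 0) ≤ q) (t : ℝ)
    (P : (Fin n → Fin n → Fin m → Bool) → Prop)
    (hP : ∀ ω : Fin n × Fin n → Shaft m, (∃ B : Fin n → Fin n → Option (Fin m),
      IsPartialLatinBox B ∧ SupportsPartial (fun r c => filled (ω (r, c))) B ∧
      (∀ r, ((Finset.univ.filter (fun c => B r c ≠ none)).card : ℝ) ≤ t) ∧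
      (∀ c, ((Finset.univ.filter (fun r => B r c ≠ none)).card : ℝ) ≤ t) ∧
      (∀ r c, B r c = none → ¬ bad (ω (r, c)).1)) → P (fun r c => filled (ω (r, c)))) :
    1 - ((n : ℝ) ^ 2 * (2 * (1 - p) ^ m * ((1 + β) ^ (2 * n) - 1))
      + 2 * n * (Real.exp (-t) * (1 + 2 * q) ^ n)) ≤ gbProb n m p P := by
  have hw := sum_shaftWt hm p
  have hnn : ∀ x : Shaft m, 0 ≤ shaftWt p x := shaftWt_nonneg h0 hp.le
  rw [gbProb_eq_prodExp]
  let F₁ : Fin n × Fin n → (Fin n × Fin n → Shaft m) → ℝ := fun i ω =>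
    if ∀ v, filled (ω i) v = true → v ∈ clashes bad ω i then 1 else 0
  let F₂ : Fin n → (Fin n × Fin n → Shaft m) → ℝ := fun r ω =>
    if t < (((Finset.univ.filter fun j : Fin n × Fin n => j.1 = r).filter
      fun j => bad (ω j).1).card : ℝ) then 1 else 0
  let F₃ : Fin n → (Fin n × Fin n → Shaft m) → ℝ := fun c ω =>
    if t < (((Finset.univ.filter fun j : Fin n × Fin n => j.2 = c).filter
      fun j => bad (ω j).1).card : ℝ) then 1 else 0
  have n₁ : ∀ i ω, 0 ≤ F₁ i ω := fun i ω => by simp only [F₁]; split_ifs <;> norm_num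
  have n₂ : ∀ i ω, 0 ≤ F₂ i ω := fun i ω => by simp only [F₂]; split_ifs <;> norm_num
  have n₃ : ∀ i ω, 0 ≤ F₃ i ω := fun i ω => by simp only [F₃]; split_ifs <;> norm_num
  have hpt : ∀ ω : Fin n × Fin n → Shaft m,
      1 - (∑ i, F₁ i ω + ∑ r, F₂ r ω + ∑ c, F₃ c ω)
        ≤ if P (fun r c => filled (ω (r, c))) then 1 else 0 := by
    intro ω
    have s₁ := Finset.sum_nonneg fun i (_ : i ∈ Finset.univ) => n₁ i ω
    have s₂ := Finset.sum_nonneg fun i (_ : i ∈ Finset.univ) => n₂ i ω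
    have s₃ := Finset.sum_nonneg fun i (_ : i ∈ Finset.univ) => n₃ i ω
    split_ifs with h
    · linarith
    · have h' := mt (hP ω) h
      have : (∃ i, F₁ i ω = 1) ∨ (∃ r, F₂ r ω = 1) ∨ ∃ c, F₃ c ω = 1 := by
        by_contra! hc
        obtain ⟨c₁, c₂, c₃⟩ := hc
        refine h' (exists_partialLatinBox bad ω t (fun i hi => c₁ i ?_)
          (fun r => not_lt.1 fun hr => c₂ r ?_) (fun c => not_lt.1 fun hr => c₃ c ?_))
        · exact if_pos hi
        · exact if_pos hr
        · exact if_pos hr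
      rcases this with ⟨i, hi⟩ | ⟨i, hi⟩ | ⟨i, hi⟩
      · have := Finset.single_le_sum (fun i _ => n₁ i ω) (Finset.mem_univ i)
        linarith
      · have := Finset.single_le_sum (fun i _ => n₂ i ω) (Finset.mem_univ i)
        linarith
      · have := Finset.single_le_sum (fun i _ => n₃ i ω) (Finset.mem_univ i)
        linarith
  refine le_trans ?_ (prodExp_mono hnn hpt)
  rw [prodExp_sub, prodExp_const hw, prodExp_add, prodExp_add, prodExp_sum, prodExp_sum,
    prodExp_sum]
  have b₁ : ∑ i, prodExp (shaftWt p) (F₁ i)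
      ≤ (n : ℝ) ^ 2 * (2 * (1 - p) ^ m * ((1 + β) ^ (2 * n) - 1)) := by
    refine (Finset.sum_le_sum fun i _ =>
      prodExp_blocked_le bad hm h0 hp hpm hβ0 hβ i).trans (le_of_eq ?_)
    rw [Finset.sum_const, Finset.card_univ, Fintype.card_prod, Fintype.card_fin, nsmul_eq_mul]
    push_cast
    ring
  have b₂ : ∑ i, prodExp (shaftWt p) (F₂ i) ≤ n * (Real.exp (-t) * (1 + 2 * q) ^ n) := by
    refine (Finset.sum_le_sum fun i _ =>
      prodExp_manyBad_le bad hm h0 hp hq0 hq t _ (card_row i)).trans (le_of_eq ?_)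
    simp
  have b₃ : ∑ i, prodExp (shaftWt p) (F₃ i) ≤ n * (Real.exp (-t) * (1 + 2 * q) ^ n) := by
    refine (Finset.sum_le_sum fun i _ =>
      prodExp_manyBad_le bad hm h0 hp hq0 hq t _ (card_col i)).trans (le_of_eq ?_)
    simp
  linarith

end Bounds

/-- A shaft is sparse if it has fewer than `L` ones among the symbols from `n` on. -/
def Sparse {m : ℕ} (n : ℕ) (L : ℝ) (a : Fin m → Bool) : Prop :=
  ((Finset.univ.filter fun v : Fin m => n ≤ (v : ℕ) ∧ a v = true).card : ℝ) < L

lemma sum_ite_le_val {n m : ℕ} (hnm : n ≤ m) (x y : ℝ) :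
    ∑ v : Fin m, (if n ≤ (v : ℕ) then x else y) = (m - n) * x + n * y := by
  obtain ⟨k, rfl⟩ := Nat.exists_eq_add_of_le hnm
  rw [Fin.sum_univ_eq_sum_range (fun i => if n ≤ i then x else y), Finset.sum_range_add,
    Finset.sum_congr rfl fun i hi => if_neg (not_le.2 (Finset.mem_range.1 hi))]
  simp
  ring

/-- The exponential moment of the number of ones of a shaft, restricted to sparse shafts. -/
lemma sum_entryWt_sparse_le {n m : ℕ} (hnm : n ≤ m) {p η L : ℝ} (h0 : 0 ≤ p) (hp : p ≤ 1)
    (hη : 0 ≤ η) :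
    ∑ a : Fin m → Bool, entryWt p a * (if Sparse n L a then (1 + η) ^ numEntries a else 0)
      ≤ Real.exp (L * Real.log 2 + p * (η * n - (1 - η) / 2 * (m - n))) := by
  have hpt : ∀ a : Fin m → Bool, (if Sparse n L a then (1 + η) ^ numEntries a else 0)
      ≤ Real.exp (L * Real.log 2) * ∏ v : Fin m,
        (if a v = true then (if n ≤ (v : ℕ) then (1 + η) / 2 else 1 + η) else 1) := by
    intro a
    have hprod : ∏ v : Fin m, (if a v = true then
          (if n ≤ (v : ℕ) then (1 + η) / 2 else 1 + η) else 1)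
        = (1 + η) ^ numEntries a
          * (1 / 2) ^ (Finset.univ.filter fun v : Fin m => n ≤ (v : ℕ) ∧ a v = true).card := by
      rw [numEntries, ← Finset.prod_const, ← Finset.prod_const, Finset.prod_filter,
        Finset.prod_filter, ← Finset.prod_mul_distrib]
      refine Finset.prod_congr rfl fun v _ => ?_
      by_cases h1 : a v = true <;> by_cases h2 : n ≤ (v : ℕ) <;> simp [h1, h2]
      ring
    rw [hprod]
    split_ifs with hs
    · set k := (Finset.univ.filter fun v : Fin m => n ≤ (v : ℕ) ∧ a v = true).card
      have hk : (k : ℝ) < L := hs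
      have h2 : ((1 : ℝ) / 2) ^ k = Real.exp (-(k * Real.log 2)) := by
        rw [Real.exp_neg, Real.exp_nat_mul, Real.exp_log (by norm_num), one_div, inv_pow]
      have h3 : 1 ≤ Real.exp (L * Real.log 2) * (1 / 2) ^ k := by
        rw [h2, ← Real.exp_add]
        apply Real.one_le_exp
        have := Real.log_pos (show (1 : ℝ) < 2 by norm_num)
        nlinarith
      have h4 : 0 ≤ (1 + η) ^ numEntries a := by positivity
      nlinarith
    · positivity
  calc _ ≤ ∑ a : Fin m → Bool, Real.exp (L * Real.log 2) * (entryWt p a * ∏ v : Fin m,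
        (if a v = true then (if n ≤ (v : ℕ) then (1 + η) / 2 else 1 + η) else 1)) := by
        refine Finset.sum_le_sum fun a _ => ?_
        rw [mul_left_comm]
        exact mul_le_mul_of_nonneg_left (hpt a) (entryWt_nonneg h0 hp a)
    _ = Real.exp (L * Real.log 2) * ∏ v : Fin m,
        (p * (if n ≤ (v : ℕ) then (1 + η) / 2 else 1 + η) + (1 - p)) := by
        rw [← Finset.mul_sum, sum_entryWt_mul_prod p (fun v b =>
          if b = true then (if n ≤ (v : ℕ) then (1 + η) / 2 else 1 + η) else 1)]
        simp
    _ ≤ Real.exp (L * Real.log 2) * ∏ v : Fin m,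
        Real.exp (if n ≤ (v : ℕ) then -(p * ((1 - η) / 2)) else p * η) := by
        gcongr with v _
        split_ifs
        · refine le_trans (le_of_eq ?_) (Real.add_one_le_exp _)
          ring
        · refine le_trans (le_of_eq ?_) (Real.add_one_le_exp _)
          ring
    _ = _ := by
        rw [← Real.exp_sum, sum_ite_le_val hnm, ← Real.exp_add]
        congr 1
        ring

lemma pow_sub_one_mul_le {w z : ℝ} (hw : 1 ≤ w) (hwz : w ≤ z) (k : ℕ) :
    (w ^ k - 1) * (z - 1) ≤ (w - 1) * (z ^ k - 1) := by
  rw [← geom_sum_mul, ← geom_sum_mul]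
  have h : ∑ i ∈ Finset.range k, w ^ i ≤ ∑ i ∈ Finset.range k, z ^ i :=
    Finset.sum_le_sum fun i _ => pow_le_pow_left₀ (by linarith) hwz i
  have h1 : 0 ≤ (w - 1) * (z - 1) := mul_nonneg (by linarith) (by linarith)
  nlinarith

lemma sum_entryWt_inv_pow_badSize_le {m : ℕ} (bad : (Fin m → Bool) → Prop) {p η q : ℝ}
    (h0 : 0 ≤ p) (hp : p ≤ 1 / 2) (hη : 0 < η) (hη1 : η ≤ 1) (hpη : 2 * p ≤ η)
    (hq : ∑ a : Fin m → Bool, entryWt p a * (if bad a then (1 + η) ^ numEntries a else 0) ≤ q) :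
    ∑ a : Fin m → Bool, entryWt p a * ((1 - p)⁻¹) ^ badSize bad a ≤ 1 + 4 * p * q / η := by
  have h1 : (1 - p)⁻¹ ≤ 1 + 2 * p := by
    rw [inv_le_iff_one_le_mul₀ (by linarith)]
    nlinarith
  have hone : 1 ≤ (1 - p)⁻¹ := (one_le_inv₀ (by linarith)).2 (by linarith)
  have hpt : ∀ a : Fin m → Bool, ((1 - p)⁻¹) ^ badSize bad a
      ≤ 1 + 4 * p / η * (if bad a then (1 + η) ^ numEntries a else 0) := by
    intro a
    by_cases hb : bad a
    · simp only [badSize, hb, if_true]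
      have h2 := pow_sub_one_mul_le hone (show (1 - p)⁻¹ ≤ 1 + η by linarith) (numEntries a + 1)
      have h3 : 0 ≤ (1 + η) ^ numEntries a := by positivity
      have h4 : ((1 - p)⁻¹) ^ (numEntries a + 1) - 1 ≤ 4 * p * (1 + η) ^ numEntries a / η := by
        rw [le_div_iff₀ hη]
        calc _ = (((1 - p)⁻¹) ^ (numEntries a + 1) - 1) * (1 + η - 1) := by ring
          _ ≤ _ := h2
          _ ≤ (2 * p) * ((1 + η) ^ numEntries a * 2) := by
            refine mul_le_mul (by linarith) ?_ ?_ (by linarith)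
            · rw [pow_succ]
              nlinarith
            · have := one_le_pow₀ (show (1 : ℝ) ≤ 1 + η by linarith) (n := numEntries a + 1)
              linarith
          _ = _ := by ring
      calc _ ≤ 1 + 4 * p * (1 + η) ^ numEntries a / η := by linarith
        _ = _ := by ring
    · simp [badSize, hb]
  calc _ ≤ ∑ a : Fin m → Bool, (entryWt p a + 4 * p / η *
        (entryWt p a * (if bad a then (1 + η) ^ numEntries a else 0))) := by
        refine Finset.sum_le_sum fun a _ => ?_
        refine (mul_le_mul_of_nonneg_left (hpt a)
          (entryWt_nonneg h0 (by linarith) a)).trans (le_of_eq ?_)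
        ring
    _ = 1 + 4 * p / η * ∑ a : Fin m → Bool,
        entryWt p a * (if bad a then (1 + η) ^ numEntries a else 0) := by
        rw [Finset.sum_add_distrib, sum_entryWt, ← Finset.mul_sum]
    _ ≤ 1 + 4 * p / η * q := by gcongr
    _ = _ := by ring

/-- The error of the union bound is small once `n` is large. -/
lemma union_bound_le {n m : ℕ} {p η q γ D X : ℝ} (hn : 0 < n) (h0 : 0 ≤ p) (hp : p ≤ 1)
    (hη : 0 < η) (hlog : 1 ≤ Real.log n)
    (hD : D = Real.log n - Real.log (Real.log n)) (hpm : 2 * D ≤ p * m)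
    (hpn : p * n ≤ 2 * Real.log n) (hq0 : 0 ≤ q) (hqX : Real.log n ^ 3 * q ≤ X)
    (hXη : 16 / η * X ≤ 1) (hXγ : X ≤ γ / 4) :
    (n : ℝ) ^ 2 * (2 * (1 - p) ^ m * ((1 + 4 * p * q / η) ^ (2 * n) - 1))
      + 2 * n * (Real.exp (-(γ * n)) * (1 + 2 * q) ^ n)
      ≤ 64 / η * X + 2 * (n * Real.exp (-(γ / 2) * n)) := by
  set l := Real.log n with hl
  have hn' : (0 : ℝ) < n := by positivity
  have hlq : l * q ≤ l ^ 3 * q := by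
    refine mul_le_mul_of_nonneg_right ?_ hq0
    exact le_self_pow₀ hlog (by norm_num)
  have hqq : q ≤ l * q := by nlinarith
  have e1 : (1 - p) ^ m ≤ l ^ 2 / (n : ℝ) ^ 2 := by
    calc (1 - p) ^ m ≤ Real.exp (-p) ^ m :=
          pow_le_pow_left₀ (by linarith) (Real.one_sub_le_exp_neg p) m
      _ = Real.exp (-(p * m)) := by
          rw [← Real.exp_nat_mul]
          congr 1
          ring
      _ ≤ Real.exp (2 * Real.log l - 2 * Real.log n) := by
          apply Real.exp_le_exp.2
          linarith
      _ = _ := by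
          rw [Real.exp_sub, mul_comm, mul_comm (2 : ℝ), Real.exp_mul, Real.exp_mul,
            Real.exp_log (by linarith), Real.exp_log hn']
          norm_num
  have e2 : (1 + 4 * p * q / η) ^ (2 * n) - 1 ≤ 2 * (16 / η * (l * q)) := by
    have h1 : (1 + 4 * p * q / η) ^ (2 * n) ≤ Real.exp (16 / η * (l * q)) := by
      calc (1 + 4 * p * q / η) ^ (2 * n) ≤ Real.exp (4 * p * q / η) ^ (2 * n) := by
            refine pow_le_pow_left₀ (by positivity) ?_ _
            linarith [Real.add_one_le_exp (4 * p * q / η)]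
        _ = Real.exp (8 / η * q * (p * n)) := by
            rw [← Real.exp_nat_mul]
            congr 1
            push_cast
            ring
        _ ≤ Real.exp (8 / η * q * (2 * l)) := by gcongr
        _ = _ := by
            congr 1
            ring
    have hs : 16 / η * (l * q) ≤ 1 := by
      refine le_trans ?_ hXη
      gcongr
      linarith
    have hs0 : 0 ≤ 16 / η * (l * q) := by positivity
    have := (le_abs_self _).trans
      (Real.abs_exp_sub_one_le (x := 16 / η * (l * q)) (by rwa [abs_of_nonneg hs0]))
    rw [abs_of_nonneg hs0] at this
    linarith
  have e2' : 0 ≤ 2 * (16 / η * (l * q)) := by positivity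
  have e3 : (1 + 2 * q) ^ n ≤ Real.exp (γ / 2 * n) := by
    calc (1 + 2 * q) ^ n ≤ Real.exp (2 * q) ^ n := by
          refine pow_le_pow_left₀ (by positivity) ?_ _
          linarith [Real.add_one_le_exp (2 * q)]
      _ = Real.exp (2 * q * n) := by
          rw [← Real.exp_nat_mul]
          congr 1
          ring
      _ ≤ _ := by
          gcongr
          linarith
  refine add_le_add ?_ ?_
  · calc _ ≤ (n : ℝ) ^ 2 * (2 * (1 - p) ^ m * (2 * (16 / η * (l * q)))) := by
          have : 0 ≤ (1 - p) ^ m := pow_nonneg (by linarith) m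
          gcongr
      _ ≤ (n : ℝ) ^ 2 * (2 * (l ^ 2 / (n : ℝ) ^ 2) * (2 * (16 / η * (l * q)))) := by gcongr
      _ = 64 / η * (l ^ 3 * q) := by
          field_simp
          ring
      _ ≤ _ := by gcongr
  · calc _ ≤ 2 * n * (Real.exp (-(γ * n)) * Real.exp (γ / 2 * n)) := by gcongr
      _ = _ := by
          rw [← Real.exp_add, mul_assoc]
          congr 3
          ring

lemma sparse_exponent_le {ε l D s n m p : ℝ} (hε : 0 < ε) (hl : 0 ≤ l) (hp : 0 ≤ p)
    (hD : D = l - s) (hpn : p * n = 2 / (1 + ε) * D) (hm : (1 + ε) * n ≤ m) :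
    ε / (1 + ε) * l * Real.log 2
        + p * (ε / (10 * (2 + ε)) * n - (1 - ε / (10 * (2 + ε))) / 2 * (m - n))
      ≤ -(ε / (1 + ε) / 5) * l + 9 / 10 * (ε / (1 + ε)) * s := by
  set η := ε / (10 * (2 + ε)) with hη
  have hη1 : η ≤ 1 := by
    rw [hη, div_le_one (by positivity)]
    linarith
  have h1 : p * (η * n - (1 - η) / 2 * (m - n)) ≤ p * (η * n - (1 - η) / 2 * (ε * n)) := by
    refine mul_le_mul_of_nonneg_left ?_ hp
    nlinarith
  have h2 : p * (η * n - (1 - η) / 2 * (ε * n)) = -(9 / 10 * (ε / (1 + ε))) * D := by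
    calc _ = (p * n) * (η - (1 - η) / 2 * ε) := by ring
      _ = _ := by
        rw [hpn, hη]
        field_simp
        ring
  have h3 : ε / (1 + ε) * l * Real.log 2 ≤ ε / (1 + ε) * l * (7 / 10) :=
    mul_le_mul_of_nonneg_left (by linarith [Real.log_two_lt_d9]) (by positivity)
  rw [h2] at h1
  subst hD
  linarith

lemma pow_three_mul_exp_le {a l κ : ℝ} (ha : 0 < a) (hl : 0 < l)
    (hκ : κ * (3 + 9 / 10 * a) = a / 10) (hs : Real.log l ≤ κ * l) :
    l ^ 3 * Real.exp (-(a / 5) * l + 9 / 10 * a * Real.log l) ≤ Real.exp (-(a / 10) * l) := by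
  have h : l ^ 3 = Real.exp (3 * Real.log l) := by
    rw [mul_comm, Real.exp_mul, Real.exp_log hl]
    norm_num
  rw [h, ← Real.exp_add]
  apply Real.exp_le_exp.2
  have : Real.log l * (3 + 9 / 10 * a) ≤ κ * l * (3 + 9 / 10 * a) :=
    mul_le_mul_of_nonneg_right hs (by positivity)
  have e : κ * l * (3 + 9 / 10 * a) = a / 10 * l := by
    rw [← hκ]
    ring
  linarith

/-- With `ε > 0`, `m = ⌈(1+ε)n⌉`, `p = (2/(1+ε))·(log n − log log n)/n` and
`M ~ M≥1(n,n,m;p)`: for every `γ > 0`, w.h.p. `M` supports a partial Latin box `B₂`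
covering at most `γn` positions in each row and column, such that every uncovered
position `(r,c)` satisfies `d_m(r,c) ≥ (ε/(1+ε))·log n`, where `d_m(r,c)` is the number
of `1`s of `M(r,c,·)` among the last `m − n` symbols. -/
theorem stmt12 (ε : ℝ) (hε : 0 < ε) (γ : ℝ) (hγ : 0 < γ) :
    Filter.Tendsto (fun n : ℕ =>
      gbProb n ⌈(1 + ε) * (n : ℝ)⌉₊
        ((2 / (1 + ε)) * (Real.log n - Real.log (Real.log n)) / n)
        (fun M => ∃ B : Fin n → Fin n → Option (Fin ⌈(1 + ε) * (n : ℝ)⌉₊),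
          IsPartialLatinBox B ∧ SupportsPartial M B ∧
          (∀ r, ((Finset.univ.filter (fun c => B r c ≠ none)).card : ℝ) ≤ γ * n) ∧
          (∀ c, ((Finset.univ.filter (fun r => B r c ≠ none)).card : ℝ) ≤ γ * n) ∧
          (∀ r c, B r c = none →
            (ε / (1 + ε)) * Real.log n ≤
              ((Finset.univ.filter (fun v : Fin ⌈(1 + ε) * (n : ℝ)⌉₊ =>
                n ≤ (v : ℕ) ∧ M r c v = true)).card : ℝ))))
      Filter.atTop (nhds 1) := by
  set a := ε / (1 + ε) with ha
  set η := ε / (10 * (2 + ε)) with hη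
  have ha0 : 0 < a := by positivity
  have ha1 : a ≤ 1 := (div_le_one (by positivity)).2 (by linarith)
  have hη0 : 0 < η := by positivity
  have hη1 : η ≤ 1 := (div_le_one (by positivity)).2 (by linarith)
  set κ := a / 10 / (3 + 9 / 10 * a) with hκ
  have hκ0 : 0 < κ := by positivity
  have hκ1 : κ ≤ 1 / 2 := by
    rw [hκ, div_le_iff₀ (by positivity)]
    linarith
  have hκa : κ * (3 + 9 / 10 * a) = a / 10 := div_mul_cancel₀ _ (by positivity)
  have tlog : Filter.Tendsto (fun n : ℕ => Real.log n) Filter.atTop Filter.atTop :=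
    Real.tendsto_log_atTop.comp tendsto_natCast_atTop_atTop
  have tX : Filter.Tendsto (fun n : ℕ => Real.exp (-(a / 10) * Real.log n))
      Filter.atTop (nhds 0) :=
    Real.tendsto_exp_atBot.comp (tlog.const_mul_atTop_of_neg (by linarith))
  have tY : Filter.Tendsto (fun n : ℕ => (n : ℝ) * Real.exp (-(γ / 2) * n))
      Filter.atTop (nhds 0) := by
    have h := (tendsto_rpow_mul_exp_neg_mul_atTop_nhds_zero 1 (γ / 2) (by positivity)).comp
      (tendsto_natCast_atTop_atTop (R := ℝ))
    simpa [Function.comp_def] using h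
  have terr : Filter.Tendsto (fun n : ℕ => 1 - (64 / η * Real.exp (-(a / 10) * Real.log n)
      + 2 * ((n : ℝ) * Real.exp (-(γ / 2) * n)))) Filter.atTop (nhds 1) := by
    simpa using ((tX.const_mul (64 / η)).add (tY.const_mul 2)).const_sub 1
  have hsmall : ∀ᶠ n : ℕ in Filter.atTop, Real.log (Real.log n) ≤ κ * Real.log n := by
    have h := tlog.eventually (Real.isLittleO_log_id_atTop.bound hκ0)
    filter_upwards [h, tlog.eventually_ge_atTop 1] with n h h1
    simp only [id, Real.norm_eq_abs, abs_of_nonneg (zero_le_one.trans h1)] at h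
    exact (le_abs_self _).trans h
  have hδ : 0 < min (1 / 4) (η / 4) := by positivity
  have hlogn : ∀ᶠ n : ℕ in Filter.atTop, Real.log n ≤ min (1 / 4) (η / 4) * n := by
    have h := (tendsto_natCast_atTop_atTop (R := ℝ)).eventually
      (Real.isLittleO_log_id_atTop.bound hδ)
    filter_upwards [h] with n h
    simp only [id, Real.norm_eq_abs, Nat.abs_cast] at h
    exact (le_abs_self _).trans h
  have hXη : ∀ᶠ n : ℕ in Filter.atTop, 16 / η * Real.exp (-(a / 10) * Real.log n) ≤ 1 := by
    have := tX.const_mul (16 / η)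
    rw [mul_zero] at this
    exact this.eventually_le_const one_pos
  have hXγ : ∀ᶠ n : ℕ in Filter.atTop, Real.exp (-(a / 10) * Real.log n) ≤ γ / 4 :=
    tX.eventually_le_const (by positivity)
  have hall : ∀ᶠ n : ℕ in Filter.atTop, 0 < n ∧ 1 ≤ Real.log n ∧
      Real.log (Real.log n) ≤ κ * Real.log n ∧ Real.log n ≤ min (1 / 4) (η / 4) * n ∧
      16 / η * Real.exp (-(a / 10) * Real.log n) ≤ 1 ∧
      Real.exp (-(a / 10) * Real.log n) ≤ γ / 4 := by
    filter_upwards [Filter.eventually_gt_atTop 0, tlog.eventually_ge_atTop 1, hsmall, hlogn, hXη,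
      hXγ] with n h1 h2 h3 h4 h5 h6
    exact ⟨h1, h2, h3, h4, h5, h6⟩
  have hparam : ∀ n : ℕ, 0 < n → 1 ≤ Real.log n → Real.log (Real.log n) ≤ κ * Real.log n →
      Real.log n ≤ min (1 / 4) (η / 4) * n → ∀ m p : ℝ, (1 + ε) * n ≤ m →
      p = (2 / (1 + ε)) * (Real.log n - Real.log (Real.log n)) / n →
      0 ≤ p ∧ p ≤ 1 / 2 ∧ 2 * p ≤ η ∧ 1 ≤ p * m ∧ p * n ≤ 2 * Real.log n ∧
      p * n = 2 / (1 + ε) * (Real.log n - Real.log (Real.log n)) ∧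
      2 * (Real.log n - Real.log (Real.log n)) ≤ p * m := by
    intro n hn hlog hs hln m p hm hp
    have hn' : (0 : ℝ) < n := by positivity
    set D := Real.log n - Real.log (Real.log n) with hD
    have hll : 0 ≤ Real.log (Real.log n) := Real.log_nonneg hlog
    have hD0 : 1 / 2 ≤ D := by nlinarith
    have hpn : p * n = 2 / (1 + ε) * D := by
      rw [hp]
      field_simp
    have hp0 : 0 ≤ p := by
      rw [hp]
      positivity
    have hpm : 2 * D ≤ p * m := by
      calc 2 * D = p * ((1 + ε) * n) := by
            rw [mul_left_comm, hpn]
            field_simp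
        _ ≤ p * m := mul_le_mul_of_nonneg_left hm hp0
    have hpn2 : p * n ≤ 2 * Real.log n := by
      rw [hpn]
      have : 2 / (1 + ε) ≤ 2 := div_le_self (by norm_num) (by linarith)
      nlinarith
    have hpδ : p ≤ 2 * min (1 / 4) (η / 4) := by
      refine le_of_mul_le_mul_right ?_ hn'
      linarith
    have m1 := min_le_left (1 / 4 : ℝ) (η / 4)
    have m2 := min_le_right (1 / 4 : ℝ) (η / 4)
    exact ⟨hp0, by linarith, by linarith, by linarith, hpn2, hpn, hpm⟩
  refine tendsto_of_tendsto_of_tendsto_of_le_of_le' terr tendsto_const_nhds ?_ ?_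
  · filter_upwards [hall] with n hn
    obtain ⟨hn, hlog, hs, hln, hXη, hXγ⟩ := hn
    have hmn : (1 + ε) * n ≤ (⌈(1 + ε) * (n : ℝ)⌉₊ : ℝ) := Nat.le_ceil _
    obtain ⟨hp0, hp2, hpη, hpm1, hpn, hpn', hpm⟩ := hparam n hn hlog hs hln _ _ hmn rfl
    have hnm : n ≤ ⌈(1 + ε) * (n : ℝ)⌉₊ := by
      have : (0 : ℝ) ≤ n := by positivity
      exact_mod_cast (show (n : ℝ) ≤ (1 + ε) * n by nlinarith).trans hmn
    have hm0 : 0 < ⌈(1 + ε) * (n : ℝ)⌉₊ := hn.trans_le hnm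
    set p := (2 / (1 + ε)) * (Real.log n - Real.log (Real.log n)) / n with hp
    set q := Real.exp (-(a / 5) * Real.log n + 9 / 10 * a * Real.log (Real.log n)) with hq
    have hqs : ∑ b : Fin ⌈(1 + ε) * (n : ℝ)⌉₊ → Bool,
        entryWt p b * (if Sparse n (a * Real.log n) b then (1 + η) ^ numEntries b else 0) ≤ q :=
      (sum_entryWt_sparse_le hnm hp0 (by linarith) hη0.le).trans (Real.exp_le_exp.2
        (sparse_exponent_le hε (by linarith) hp0 rfl hpn' hmn))
    have hqs' : ∑ b : Fin ⌈(1 + ε) * (n : ℝ)⌉₊ → Bool,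
        entryWt p b * (if Sparse n (a * Real.log n) b then 1 else 0) ≤ q := by
      refine le_trans (Finset.sum_le_sum fun b _ => ?_) hqs
      refine mul_le_mul_of_nonneg_left ?_ (entryWt_nonneg hp0 (by linarith) b)
      split_ifs
      · exact one_le_pow₀ (by linarith)
      · exact le_rfl
    have hq0 : 0 ≤ q := (Real.exp_pos _).le
    refine le_trans (sub_le_sub_left (union_bound_le (D := Real.log n - Real.log (Real.log n))
      hn hp0 (by linarith) hη0 hlog rfl hpm hpn hq0
      (pow_three_mul_exp_le ha0 (by linarith) hκa hs) hXη hXγ) 1) ?_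
    refine le_gbProb (Sparse n (a * Real.log n)) hm0 hp0 (by linarith) hpm1 (by positivity)
      (sum_entryWt_inv_pow_badSize_le _ hp0 hp2 hη0 hη1 hpη hqs) hq0 hqs' (γ * n) _ ?_
    rintro ω ⟨B, h1, h2, h3, h4, h5⟩
    refine ⟨B, h1, h2, h3, h4, fun r c h => (not_lt.1 (h5 r c h)).trans (Nat.cast_le.2 ?_)⟩
    refine Finset.card_le_card fun v hv => ?_
    simp only [Finset.mem_filter, Finset.mem_univ, true_and] at hv ⊢
    exact ⟨hv.1, by simp [filled, hv.2]⟩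
  · filter_upwards [hall] with n hn
    obtain ⟨hn, hlog, hs, hln, -, -⟩ := hn
    have hmn : (1 + ε) * n ≤ (⌈(1 + ε) * (n : ℝ)⌉₊ : ℝ) := Nat.le_ceil _
    obtain ⟨hp0, hp2, -⟩ := hparam n hn hlog hs hln _ _ hmn rfl
    exact gbProb_le_one (Nat.ceil_pos.2 (by positivity)) hp0 (by linarith) _

end
end

section
/- Let q = q(n) satisfy q·n → ∞ and q ≤ 1, and let M ~ M(n,n,n;q). Then for every γ > 0, with probability tending to 1 as n → ∞, M supports a partial Latin box that leaves at most γn positions uncovered in each row and in each column. -/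
attribute [local instance] Classical.propDecidable

noncomputable section

section BernoulliProduct

variable {ι : Type*} [Fintype ι]

/-- The Bernoulli weight of a single bit. -/
def bern (p : ℝ) (b : Bool) : ℝ := if b = true then p else 1 - p

/-- The weight of a family of independent Bernoulli bits. -/
def weight (p : ℝ) (x : ι → Bool) : ℝ := ∏ i, bern p (x i)

/-- The probability of an event for independent Bernoulli bits. -/
def prob (p : ℝ) (E : (ι → Bool) → Prop) : ℝ := ∑ x, if E x then weight p x else 0

lemma bern_nonneg {p : ℝ} (h0 : 0 ≤ p) (h1 : p ≤ 1) (b : Bool) : 0 ≤ bern p b := by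
  unfold bern; split_ifs <;> linarith

lemma weight_nonneg {p : ℝ} (h0 : 0 ≤ p) (h1 : p ≤ 1) (x : ι → Bool) : 0 ≤ weight p x :=
  Finset.prod_nonneg fun _ _ => bern_nonneg h0 h1 _

lemma sum_prod_bits (h : ι → Bool → ℝ) :
    ∑ x : ι → Bool, ∏ i, h i (x i) = ∏ i, ∑ b, h i b := by
  rw [Finset.prod_univ_sum, Fintype.piFinset_univ]

lemma sum_weight_mul_prod (p : ℝ) (h : ι → Bool → ℝ) :
    ∑ x : ι → Bool, weight p x * ∏ i, h i (x i)
      = ∏ i, (p * h i true + (1 - p) * h i false) := by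
  simp only [weight, ← Finset.prod_mul_distrib]
  rw [sum_prod_bits (fun i b => bern p b * h i b)]
  simp [bern]

lemma sum_weight (p : ℝ) : ∑ x : ι → Bool, weight p x = 1 := by
  have := sum_weight_mul_prod (ι := ι) p (fun _ _ => 1)
  simpa using this

lemma sum_weight_comp {p s t : ℝ} (g : ι → Bool → Bool → Bool)
    (hg : ∀ i b, (∑ a, ∑ a', if g i a a' = b then bern p a * bern s a' else 0) = bern t b)
    (F : (ι → Bool) → ℝ) :
    ∑ x, ∑ y, weight p x * weight s y * F (fun i => g i (x i) (y i)) = ∑ z, weight t z * F z := by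
  have key : ∀ z : ι → Bool, weight t z =
      ∑ x, ∑ y, if (fun i => g i (x i) (y i)) = z then weight p x * weight s y else 0 := by
    intro z
    unfold weight
    rw [Finset.prod_congr rfl fun i _ => (hg i (z i)).symm]
    rw [← sum_prod_bits (fun i a => ∑ a', if g i a a' = z i then bern p a * bern s a' else 0)]
    refine Finset.sum_congr rfl fun x _ => ?_
    rw [← sum_prod_bits (fun i a' => if g i (x i) a' = z i then bern p (x i) * bern s a' else 0)]
    refine Finset.sum_congr rfl fun y _ => ?_
    rw [Finset.prod_ite_zero]
    simp [funext_iff, Finset.prod_mul_distrib]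
  simp only [key, Finset.sum_mul]
  symm
  rw [Finset.sum_comm]
  refine Finset.sum_congr rfl fun x _ => ?_
  rw [Finset.sum_comm]
  refine Finset.sum_congr rfl fun y _ => ?_
  simp

lemma prob_nonneg {p : ℝ} (h0 : 0 ≤ p) (h1 : p ≤ 1) (E : (ι → Bool) → Prop) : 0 ≤ prob p E :=
  Finset.sum_nonneg fun x _ => by
    split_ifs
    exacts [weight_nonneg h0 h1 x, le_rfl]

lemma prob_mono {p : ℝ} (h0 : 0 ≤ p) (h1 : p ≤ 1) {E F : (ι → Bool) → Prop}
    (h : ∀ x, E x → F x) : prob p E ≤ prob p F :=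
  Finset.sum_le_sum fun x _ => by
    have := weight_nonneg h0 h1 x
    by_cases hE : E x
    · simp [hE, h x hE]
    · simp only [hE, if_false]
      split_ifs
      exacts [this, le_rfl]

lemma prob_add_prob_not (p : ℝ) (E : (ι → Bool) → Prop) :
    prob p E + prob p (fun x => ¬ E x) = 1 := by
  rw [← sum_weight (ι := ι) p, prob, prob, ← Finset.sum_add_distrib]
  refine Finset.sum_congr rfl fun x _ => ?_
  by_cases h : E x <;> simp [h]

lemma prob_le_one {p : ℝ} (h0 : 0 ≤ p) (h1 : p ≤ 1) (E : (ι → Bool) → Prop) : prob p E ≤ 1 := by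
  have := prob_add_prob_not p E
  have := prob_nonneg h0 h1 (fun x => ¬ E x)
  linarith

lemma prob_or_le {p : ℝ} (h0 : 0 ≤ p) (h1 : p ≤ 1) (E F : (ι → Bool) → Prop) :
    prob p (fun x => E x ∨ F x) ≤ prob p E + prob p F := by
  rw [prob, prob, prob, ← Finset.sum_add_distrib]
  refine Finset.sum_le_sum fun x _ => ?_
  have := weight_nonneg h0 h1 x
  by_cases hE : E x <;> by_cases hF : F x <;> simp [hE, hF, this]

lemma prob_exists_le {α : Type*} {p : ℝ} (h0 : 0 ≤ p) (h1 : p ≤ 1) (s : Finset α)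
    (E : α → (ι → Bool) → Prop) :
    prob p (fun x => ∃ a ∈ s, E a x) ≤ ∑ a ∈ s, prob p (E a) := by
  unfold prob
  rw [Finset.sum_comm]
  refine Finset.sum_le_sum fun x _ => ?_
  have h := weight_nonneg h0 h1 x
  have hn : ∀ a ∈ s, 0 ≤ (if E a x then weight p x else 0) := fun a _ => by
    split_ifs
    exacts [h, le_rfl]
  split_ifs with hE
  · obtain ⟨a, ha, hE⟩ := hE
    calc weight p x = if E a x then weight p x else 0 := by simp [hE]
      _ ≤ _ := Finset.single_le_sum hn ha
  · exact Finset.sum_nonneg hn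

lemma prob_comp_equiv (p : ℝ) (e : ι ≃ ι) (E : (ι → Bool) → Prop) :
    prob p (fun x => E (x ∘ e)) = prob p E := by
  unfold prob
  refine Fintype.sum_equiv (Equiv.arrowCongr e.symm (Equiv.refl Bool)) _ _ fun x => ?_
  have : weight p (x ∘ e) = weight p x := Equiv.prod_comp e fun i => bern p (x i)
  have h2 : (Equiv.arrowCongr e.symm (Equiv.refl Bool)) x = x ∘ e := by
    ext i; simp [Equiv.arrowCongr]
  rw [h2, this]

/-- Two-stage revealing: if every outcome of the first stage in `A` fails the event
`E` in the second stage with probability at most `b`, then `E` fails for the combined bits with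
probability at most `a + b`. -/
lemma prob_not_le_add {p s t a b : ℝ} (hp0 : 0 ≤ p) (hp1 : p ≤ 1) (hs0 : 0 ≤ s) (hs1 : s ≤ 1)
    (g : ι → Bool → Bool → Bool)
    (hg : ∀ i b, (∑ a, ∑ a', if g i a a' = b then bern p a * bern s a' else 0) = bern t b)
    {A E : (ι → Bool) → Prop} (hA : prob p (fun x => ¬ A x) ≤ a) (hb : 0 ≤ b)
    (hE : ∀ x, A x → prob s (fun y => ¬ E (fun i => g i (x i) (y i))) ≤ b) :
    prob t (fun z => ¬ E z) ≤ a + b := by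
  have h1 : prob t (fun z => ¬ E z) =
      ∑ x, weight p x * prob s (fun y => ¬ E (fun i => g i (x i) (y i))) := by
    have := sum_weight_comp g hg (fun z => if ¬ E z then 1 else 0)
    simp only [mul_ite, mul_one, mul_zero] at this
    unfold prob
    simp only [Finset.mul_sum, mul_ite, mul_zero]
    convert this.symm
  have h2 : a + b ≥ ∑ x, ((if ¬ A x then weight p x else 0) + weight p x * b) := by
    rw [Finset.sum_add_distrib, ← Finset.sum_mul, sum_weight, one_mul]
    refine le_trans (le_of_eq ?_) (add_le_add_left hA b)
    unfold prob
    congr!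
  rw [h1]
  refine le_trans (Finset.sum_le_sum fun x _ => ?_) h2
  have hw := weight_nonneg hp0 hp1 x
  by_cases hAx : A x
  · simpa [hAx] using mul_le_mul_of_nonneg_left (hE x hAx) hw
  · have := mul_le_mul_of_nonneg_left
      (prob_le_one hs0 hs1 (fun y => ¬ E (fun i => g i (x i) (y i)))) hw
    have := mul_nonneg hw hb
    simp only [hAx, not_false_eq_true, if_true]
    linarith

lemma bern_or (p s : ℝ) (b : Bool) :
    (∑ a, ∑ a', if (a || a') = b then bern p a * bern s a' else 0)
      = bern (p + s - p * s) b := by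
  cases b <;> simp [bern] <;> ring

lemma bern_select {P : Prop} [Decidable P] (p : ℝ) (b : Bool) :
    (∑ a, ∑ a', if (if P then a' else a) = b then bern p a * bern p a' else 0) = bern p b := by
  by_cases h : P <;> cases b <;> simp [bern, h] <;> ring

lemma prob_mono_param {p q : ℝ} (hp0 : 0 ≤ p) (hpq : p ≤ q) (hp1 : p < 1) (hq1 : q ≤ 1)
    {E : (ι → Bool) → Prop} (hE : ∀ x y : ι → Bool, E x → E (fun i => x i || y i)) :
    prob q (fun x => ¬ E x) ≤ prob p (fun x => ¬ E x) := by
  have hpos : 0 < 1 - p := by linarith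
  have hs0 : 0 ≤ (q - p) / (1 - p) := div_nonneg (by linarith) hpos.le
  have hs1 : (q - p) / (1 - p) ≤ 1 := (div_le_one hpos).2 (by linarith)
  have hq : p + (q - p) / (1 - p) - p * ((q - p) / (1 - p)) = q := by
    field_simp; ring
  have := prob_not_le_add (ι := ι) (t := q) hp0 hp1.le hs0 hs1 (fun _ a a' => a || a')
    (fun _ b => by rw [bern_or, hq]) (A := E) (E := E) le_rfl le_rfl (fun x hx => by
      have : (fun y : ι → Bool => ¬ E (fun i => x i || y i)) = fun _ => False := by
        ext y; simp [hE x y hx]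
      rw [this]; simp [prob])
  linarith

lemma prob_forall_false_le {p : ℝ} (h1 : p ≤ 1) (S : Finset ι) :
    prob p (fun x => ∀ i ∈ S, x i = false) ≤ Real.exp (-(p * S.card)) := by
  have h : prob p (fun x => ∀ i ∈ S, x i = false) = (1 - p) ^ S.card := by
    have := sum_weight_mul_prod p (fun (i : ι) b => if i ∈ S ∧ b = true then 0 else 1)
    have e : ∀ i : ι, (p * (if i ∈ S ∧ true = true then 0 else 1)
        + (1 - p) * (if i ∈ S ∧ false = true then 0 else 1)) = if i ∈ S then 1 - p else 1 := by
      intro i; by_cases hi : i ∈ S <;> simp [hi]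
    rw [Finset.prod_congr rfl fun i _ => e i, Finset.prod_ite_mem] at this
    simp only [Finset.univ_inter, Finset.prod_const] at this
    rw [← this, prob]
    refine Finset.sum_congr rfl fun x _ => ?_
    split_ifs with hx
    · rw [Finset.prod_eq_one, mul_one]
      intro i _
      by_cases hi : i ∈ S <;> simp [hi, hx]
    · push Not at hx
      obtain ⟨i, hi, hxi⟩ := hx
      rw [Finset.prod_eq_zero (Finset.mem_univ i), mul_zero]
      simpa [hi] using hxi
  rw [h, show -(p * (S.card : ℝ)) = S.card * (-p) by ring, Real.exp_nat_mul]
  refine pow_le_pow_left₀ (by linarith) ?_ _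
  have := Real.add_one_le_exp (-p)
  linarith

lemma prob_le_card_filter_le {p u a : ℝ} (hp0 : 0 ≤ p) (hp1 : p ≤ 1) (hu : 0 ≤ u)
    (S : Finset ι) :
    prob p (fun x => a < (S.filter (fun i => x i = true)).card) ≤
      Real.exp (p * (Real.exp u - 1) * S.card - u * a) := by
  have h := sum_weight_mul_prod p (fun (i : ι) b => if i ∈ S ∧ b = true then Real.exp u else 1)
  have e : ∀ i : ι, (p * (if i ∈ S ∧ true = true then Real.exp u else 1)
      + (1 - p) * (if i ∈ S ∧ false = true then Real.exp u else 1))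
      = if i ∈ S then 1 + p * (Real.exp u - 1) else 1 := by
    intro i; by_cases hi : i ∈ S <;> simp [hi]; ring
  rw [Finset.prod_congr rfl fun i _ => e i, Finset.prod_ite_mem] at h
  simp only [Finset.univ_inter, Finset.prod_const] at h
  have hx : ∀ x : ι → Bool, (∏ i, if i ∈ S ∧ x i = true then Real.exp u else 1)
      = Real.exp (u * (S.filter (fun i => x i = true)).card) := by
    intro x
    rw [mul_comm, Real.exp_nat_mul, ← Finset.prod_const, Finset.prod_filter,
      ← Finset.prod_ite_mem_eq S]
    refine Finset.prod_congr rfl fun i _ => ?_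
    by_cases hi : i ∈ S <;> simp [hi]
  simp only [hx] at h
  have h2 : prob p (fun x => a < (S.filter (fun i => x i = true)).card) ≤
      Real.exp (-(u * a)) * (1 + p * (Real.exp u - 1)) ^ S.card := by
    rw [← h, Finset.mul_sum]
    refine Finset.sum_le_sum fun x _ => ?_
    have hw := weight_nonneg hp0 hp1 x
    split_ifs with hax
    · have : 1 ≤ Real.exp (-(u * a)) * Real.exp (u * (S.filter (fun i => x i = true)).card) := by
        rw [← Real.exp_add]
        apply Real.one_le_exp
        have := mul_le_mul_of_nonneg_left hax.le hu
        linarith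
      nlinarith
    · positivity
  refine h2.trans ?_
  rw [show p * (Real.exp u - 1) * S.card - u * a = -(u * a) + p * (Real.exp u - 1) * S.card by ring,
    Real.exp_add]
  refine mul_le_mul_of_nonneg_left ?_ (Real.exp_nonneg _)
  rw [mul_comm _ (S.card : ℝ), Real.exp_nat_mul]
  have hu1 : 0 ≤ Real.exp u - 1 := by linarith [Real.one_le_exp hu]
  refine pow_le_pow_left₀ (by positivity) ?_ _
  have := Real.add_one_le_exp (p * (Real.exp u - 1))
  linarith

end BernoulliProduct

section LatinSets

variable {n : ℕ}

/-- A set of triples (row, column, symbol) any two of which share at most one coordinate. -/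
def IsLatinSet (L : Finset (Fin n × Fin n × Fin n)) : Prop :=
  (∀ x ∈ L, ∀ y ∈ L, x.1 = y.1 → x.2.1 = y.2.1 → x = y) ∧
  (∀ x ∈ L, ∀ y ∈ L, x.1 = y.1 → x.2.2 = y.2.2 → x = y) ∧
  (∀ x ∈ L, ∀ y ∈ L, x.2.1 = y.2.1 → x.2.2 = y.2.2 → x = y)

/-- The number of covered positions in row `r`. -/
def rowCard (L : Finset (Fin n × Fin n × Fin n)) (r : Fin n) : ℕ :=
  (L.filter (fun x => x.1 = r)).card

/-- The number of covered positions in column `c`. -/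
def colCard (L : Finset (Fin n × Fin n × Fin n)) (c : Fin n) : ℕ :=
  (L.filter (fun x => x.2.1 = c)).card

/-- The pairs (column, symbol) in `A × B` that are not used by `L`. -/
def freePairs (L : Finset (Fin n × Fin n × Fin n)) (A B : Finset (Fin n)) :
    Finset (Fin n × Fin n) :=
  (A ×ˢ B).filter (fun x => ∀ r, (r, x) ∉ L)

lemma card_filter_col_le {L : Finset (Fin n × Fin n × Fin n)} (hL : IsLatinSet L)
    {R : Finset (Fin n)} (hR : ∀ x ∈ L, x.1 ∈ R) (A : Finset (Fin n)) :
    (L.filter (fun x => x.2.1 ∈ A)).card ≤ R.card * A.card := by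
  rw [← Finset.card_product]
  refine Finset.card_le_card_of_injOn (fun x => (x.1, x.2.1)) ?_ ?_
  · intro x hx
    simp only [Finset.coe_filter, Set.mem_ofPred_eq] at hx
    simp [hR x hx.1, hx.2]
  · intro x hx y hy hxy
    simp only [Finset.coe_filter, Set.mem_ofPred_eq] at hx hy
    simp only [Prod.mk.injEq] at hxy
    exact hL.1 x hx.1 y hy.1 hxy.1 hxy.2

lemma card_filter_symbol_le {L : Finset (Fin n × Fin n × Fin n)} (hL : IsLatinSet L)
    {R : Finset (Fin n)} (hR : ∀ x ∈ L, x.1 ∈ R) (B : Finset (Fin n)) :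
    (L.filter (fun x => x.2.2 ∈ B)).card ≤ R.card * B.card := by
  rw [← Finset.card_product]
  refine Finset.card_le_card_of_injOn (fun x => (x.1, x.2.2)) ?_ ?_
  · intro x hx
    simp only [Finset.coe_filter, Set.mem_ofPred_eq] at hx
    simp [hR x hx.1, hx.2]
  · intro x hx y hy hxy
    simp only [Finset.coe_filter, Set.mem_ofPred_eq] at hx hy
    simp only [Prod.mk.injEq] at hxy
    exact hL.2.1 x hx.1 y hy.1 hxy.1 hxy.2

lemma card_filter_pair_le {L : Finset (Fin n × Fin n × Fin n)} (hL : IsLatinSet L)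
    (S : Finset (Fin n × Fin n)) :
    (L.filter (fun x => x.2 ∈ S)).card ≤ S.card := by
  refine Finset.card_le_card_of_injOn (fun x => x.2) ?_ ?_
  · intro x hx
    simp only [Finset.coe_filter, Set.mem_ofPred_eq] at hx
    simp [hx.2]
  · intro x hx y hy hxy
    simp only [Finset.coe_filter, Set.mem_ofPred_eq] at hx hy
    exact hL.2.2 x hx.1 y hy.1 (congrArg Prod.fst hxy) (congrArg Prod.snd hxy)

lemma le_card_freePairs {L : Finset (Fin n × Fin n × Fin n)} (hL : IsLatinSet L)
    {R : Finset (Fin n)} (hR : ∀ x ∈ L, x.1 ∈ R) (A B : Finset (Fin n)) :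
    ((n : ℝ) - R.card) * (A.card + B.card - n) - (n * R.card - L.card)
      ≤ (freePairs L A B).card := by
  have hA := card_filter_col_le hL hR A
  have hB := card_filter_symbol_le hL hR B
  have hC := card_filter_pair_le hL (Aᶜ ×ˢ Bᶜ)
  have hfree : A.card * B.card ≤
      (freePairs L A B).card + (L.filter (fun x => x.2.1 ∈ A ∧ x.2.2 ∈ B)).card := by
    rw [← Finset.card_product, ← Finset.card_filter_add_card_filter_not (s := A ×ˢ B)
      (fun x => ∀ r, (r, x) ∉ L)]
    refine Nat.add_le_add_left ?_ _
    refine (Finset.card_le_card (t := (L.filter (fun x => x.2.1 ∈ A ∧ x.2.2 ∈ B)).image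
      (fun x => x.2)) ?_).trans Finset.card_image_le
    intro x hx
    simp only [Finset.mem_filter, Finset.mem_product, not_forall, not_not] at hx
    obtain ⟨⟨h1, h2⟩, r, hr⟩ := hx
    exact Finset.mem_image.2 ⟨(r, x), by simp [hr, h1, h2], rfl⟩
  have hincl : (L.filter (fun x => x.2.1 ∈ A ∧ x.2.2 ∈ B)).card + L.card =
      (L.filter (fun x => x.2.1 ∈ A)).card + (L.filter (fun x => x.2.2 ∈ B)).card
        + (L.filter (fun x => x.2 ∈ Aᶜ ×ˢ Bᶜ)).card := by
    simp only [Finset.card_filter, Finset.card_eq_sum_ones L, ← Finset.sum_add_distrib]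
    refine Finset.sum_congr rfl fun x _ => ?_
    by_cases h1 : x.2.1 ∈ A <;> by_cases h2 : x.2.2 ∈ B <;> simp [h1, h2]
  rw [Finset.card_product, Finset.card_compl, Finset.card_compl, Fintype.card_fin] at hC
  have hAn : A.card ≤ n := by simpa using Finset.card_le_univ A
  have hBn : B.card ≤ n := by simpa using Finset.card_le_univ B
  rify [hAn, hBn] at hA hB hC hfree hincl
  nlinarith

lemma exists_matching_of_defect {k : ℕ} (G : Fin n → Fin n → Prop)
    (h : ∀ A : Finset (Fin n),
      A.card ≤ (Finset.univ.filter (fun v => ∃ c ∈ A, G c v)).card + k) :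
    ∃ P : Finset (Fin n × Fin n), (∀ x ∈ P, G x.1 x.2) ∧
      (∀ x ∈ P, ∀ y ∈ P, x.1 = y.1 → x = y) ∧ (∀ x ∈ P, ∀ y ∈ P, x.2 = y.2 → x = y) ∧
      n ≤ P.card + k := by
  let N : Fin n → Finset (Fin n ⊕ Fin k) := fun c =>
    (Finset.univ.filter (fun v => G c v)).disjSum Finset.univ
  have hall : ∀ A : Finset (Fin n), A.card ≤ (A.biUnion N).card := by
    intro A
    rcases A.eq_empty_or_nonempty with rfl | ⟨c₀, hc₀⟩
    · simp
    refine (h A).trans ?_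
    have hcard := Finset.card_disjSum (Finset.univ.filter (fun v => ∃ c ∈ A, G c v))
      (Finset.univ : Finset (Fin k))
    rw [Finset.card_univ, Fintype.card_fin] at hcard
    rw [← hcard]
    refine Finset.card_le_card ?_
    rintro (v | d) hx
    · simpa [N] using hx
    · simp only [N, Finset.mem_biUnion, Finset.inr_mem_disjSum]
      exact ⟨c₀, hc₀, Finset.mem_univ d⟩
  obtain ⟨f, hf, hfN⟩ := (Finset.all_card_le_biUnion_card_iff_exists_injective N).1 hall
  let P : Finset (Fin n × Fin n) := Finset.univ.filter (fun x => f x.1 = Sum.inl x.2)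
  have hP : ∀ x, x ∈ P ↔ f x.1 = Sum.inl x.2 := fun x => by simp [P]
  refine ⟨P, ?_, ?_, ?_, ?_⟩
  · intro x hx
    have := hfN x.1
    rw [(hP x).1 hx] at this
    simpa [N] using this
  · intro x hx y hy hxy
    have h1 := (hP x).1 hx
    rw [hxy, (hP y).1 hy] at h1
    exact Prod.ext hxy (Sum.inl_injective h1).symm
  · intro x hx y hy hxy
    have h1 := (hP x).1 hx
    rw [hxy, ← (hP y).1 hy] at h1
    exact Prod.ext (hf h1) hxy
  · have : (Finset.univ : Finset (Fin n)) ⊆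
        P.image Prod.fst ∪ Finset.univ.filter (fun c => ∃ d, f c = Sum.inr d) := by
      intro c _
      rcases hc : f c with v | d
      · exact Finset.mem_union_left _ (Finset.mem_image.2 ⟨(c, v), (hP _).2 hc, rfl⟩)
      · exact Finset.mem_union_right _ (by simp [hc])
    have h2 := (Finset.card_le_card this).trans (Finset.card_union_le _ _)
    have h3 : (Finset.univ.filter (fun c => ∃ d, f c = Sum.inr d)).card ≤ k := by
      calc _ ≤ ((Finset.univ : Finset (Fin k)).image Sum.inr : Finset (Fin n ⊕ Fin k)).card := by
            refine Finset.card_le_card_of_injOn f ?_ hf.injOn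
            intro c hc
            simp only [Finset.coe_filter, Finset.mem_univ, true_and, Set.mem_ofPred_eq] at hc
            obtain ⟨d, hd⟩ := hc
            simp [hd]
        _ ≤ _ := Finset.card_image_le.trans (by simp)
    have h4 : (P.image Prod.fst).card ≤ P.card := Finset.card_image_le
    rw [Finset.card_univ, Fintype.card_fin] at h2
    omega

/-- If no large rectangle of free pairs avoids row `r` of `M`, then a Latin set can be extended
to the new row `r`. -/
lemma exists_extend_row {L : Finset (Fin n × Fin n × Fin n)} (hL : IsLatinSet L)
    {R : Finset (Fin n)} (hR : ∀ x ∈ L, x.1 ∈ R) {r : Fin n} (hr : r ∉ R)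
    {M : Fin n × Fin n × Fin n → Bool} {κ : ℝ} (hκ : 0 ≤ κ)
    (hM : ∀ A B : Finset (Fin n), n + κ < A.card + B.card →
      ∃ x ∈ freePairs L A B, M (r, x) = true) :
    ∃ L' : Finset (Fin n × Fin n × Fin n), IsLatinSet L' ∧ L ⊆ L' ∧
      (∀ x ∈ L', x ∈ L ∨ x.1 = r ∧ M x = true) ∧ (n - κ ≤ rowCard L' r) ∧
      (L'.card = L.card + rowCard L' r) := by
  obtain ⟨P, hPG, hP1, hP2, hPc⟩ := exists_matching_of_defect (n := n) (k := ⌊κ⌋₊)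
    (fun c v => M (r, c, v) = true ∧ ∀ r', (r', c, v) ∉ L) (by
      intro A
      by_contra! hlt
      set N := Finset.univ.filter (fun v => ∃ c ∈ A, M (r, c, v) = true ∧ ∀ r', (r', c, v) ∉ L)
        with hN
      have hlt' : N.card + ⌊κ⌋₊ < A.card := by
        convert hlt
        rfl
      have hNn : N.card ≤ n := by simpa using Finset.card_le_univ N
      obtain ⟨x, hx, hMx⟩ := hM A Nᶜ (by
        rw [Finset.card_compl, Fintype.card_fin, Nat.cast_sub hNn]
        have h1 := Nat.lt_floor_add_one κ
        have h2 : ((N.card + ⌊κ⌋₊ + 1 : ℕ) : ℝ) ≤ A.card := by exact_mod_cast hlt'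
        push_cast at h2
        linarith)
      simp only [freePairs, Finset.mem_filter, Finset.mem_product, Finset.mem_compl] at hx
      refine hx.1.2 ?_
      rw [hN]
      simp only [Finset.mem_filter, Finset.mem_univ, true_and]
      exact ⟨x.1, hx.1.1, hMx, hx.2⟩)
  set Q : Finset (Fin n × Fin n × Fin n) := P.image (fun x => (r, x)) with hQ
  have hQP : ∀ x, x ∈ Q ↔ x.1 = r ∧ x.2 ∈ P := by
    rintro ⟨a, x⟩
    simp only [hQ, Finset.mem_image, Prod.mk.injEq]
    constructor
    · rintro ⟨y, hy, rfl, rfl⟩; exact ⟨rfl, hy⟩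
    · rintro ⟨rfl, hx⟩; exact ⟨x, hx, rfl, rfl⟩
  have hQcard : Q.card = P.card := Finset.card_image_of_injective _ (Prod.mk_right_injective r)
  have hne : ∀ x ∈ L, x.1 ≠ r := by
    rintro x hx rfl
    exact hr (hR x hx)
  have hrow : (L ∪ Q).filter (fun x => x.1 = r) = Q := by
    ext x
    simp only [Finset.mem_filter, Finset.mem_union, hQP]
    constructor
    · rintro ⟨h | h, h'⟩
      · exact absurd h' (hne x h)
      · exact h
    · intro h; exact ⟨Or.inr h, h.1⟩
  have hdisj : Disjoint L Q := by
    rw [Finset.disjoint_left]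
    intro x hx hxQ
    exact hne x hx ((hQP x).1 hxQ).1
  refine ⟨L ∪ Q, ⟨?_, ?_, ?_⟩, Finset.subset_union_left, ?_, ?_, ?_⟩
  · intro x hx y hy h1 h2
    rcases Finset.mem_union.1 hx with hx | hx <;> rcases Finset.mem_union.1 hy with hy | hy
    · exact hL.1 x hx y hy h1 h2
    · exact absurd (h1.trans ((hQP y).1 hy).1) (hne x hx)
    · exact absurd (h1.symm.trans ((hQP x).1 hx).1) (hne y hy)
    · exact Prod.ext h1 (hP1 _ ((hQP x).1 hx).2 _ ((hQP y).1 hy).2 h2)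
  · intro x hx y hy h1 h2
    rcases Finset.mem_union.1 hx with hx | hx <;> rcases Finset.mem_union.1 hy with hy | hy
    · exact hL.2.1 x hx y hy h1 h2
    · exact absurd (h1.trans ((hQP y).1 hy).1) (hne x hx)
    · exact absurd (h1.symm.trans ((hQP x).1 hx).1) (hne y hy)
    · exact Prod.ext h1 (hP2 _ ((hQP x).1 hx).2 _ ((hQP y).1 hy).2 h2)
  · intro x hx y hy h1 h2
    rcases Finset.mem_union.1 hx with hx | hx <;> rcases Finset.mem_union.1 hy with hy | hy
    · exact hL.2.2 x hx y hy h1 h2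
    · refine absurd ?_ ((hPG _ ((hQP y).1 hy).2).2 x.1)
      rwa [← h1, ← h2]
    · refine absurd ?_ ((hPG _ ((hQP x).1 hx).2).2 y.1)
      rwa [h1, h2]
    · exact Prod.ext (((hQP x).1 hx).1.trans ((hQP y).1 hy).1.symm)
        (hP1 _ ((hQP x).1 hx).2 _ ((hQP y).1 hy).2 h1)
  · intro x hx
    rcases Finset.mem_union.1 hx with hx | hx
    · exact Or.inl hx
    · obtain ⟨h1, h2⟩ := (hQP x).1 hx
      refine Or.inr ⟨h1, ?_⟩
      rw [← (hPG _ h2).1, ← h1]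
  · rw [rowCard, hrow, hQcard]
    have h1 := Nat.floor_le hκ
    have h2 : (n : ℝ) ≤ P.card + ⌊κ⌋₊ := by exact_mod_cast hPc
    linarith
  · rw [rowCard, hrow, Finset.card_union_of_disjoint hdisj]

end LatinSets

section RowProcess

variable {n : ℕ}

lemma prob_avoid_rectangle_le {p : ℝ} (h0 : 0 ≤ p) (h1 : p ≤ 1)
    (L : Finset (Fin n × Fin n × Fin n)) (r : Fin n) {κ m : ℝ}
    (hm : ∀ A B : Finset (Fin n), n + κ < A.card + B.card → m ≤ (freePairs L A B).card) :
    prob p (fun y : Fin n × Fin n × Fin n → Bool => ∃ A B : Finset (Fin n),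
      n + κ < A.card + B.card ∧ ∀ x ∈ freePairs L A B, y (r, x) = false)
      ≤ 4 ^ n * Real.exp (-(p * m)) := by
  let s : Finset (Finset (Fin n) × Finset (Fin n)) :=
    Finset.univ.filter (fun D => n + κ < D.1.card + D.2.card)
  have hs : (s.card : ℝ) ≤ 4 ^ n := by
    have : s.card ≤ 4 ^ n := by
      refine (Finset.card_le_univ s).trans ?_
      rw [Fintype.card_prod, Fintype.card_finset, Fintype.card_fin, ← mul_pow]
      norm_num
    exact_mod_cast this
  calc _ ≤ prob p (fun y : Fin n × Fin n × Fin n → Bool => ∃ D ∈ s,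
        ∀ i ∈ (freePairs L D.1 D.2).image (fun x => (r, x)), y i = false) := by
        refine prob_mono h0 h1 ?_
        rintro y ⟨A, B, hAB, hy⟩
        refine ⟨(A, B), by simpa [s] using hAB, ?_⟩
        intro i hi
        obtain ⟨x, hx, rfl⟩ := Finset.mem_image.1 hi
        exact hy x hx
    _ ≤ ∑ D ∈ s, prob p (fun y : Fin n × Fin n × Fin n → Bool =>
        ∀ i ∈ (freePairs L D.1 D.2).image (fun x => (r, x)), y i = false) :=
        prob_exists_le h0 h1 s _
    _ ≤ ∑ D ∈ s, Real.exp (-(p * m)) := by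
        refine Finset.sum_le_sum fun D hD => (prob_forall_false_le h1 _).trans ?_
        rw [Finset.card_image_of_injective _ (Prod.mk_right_injective r)]
        have := mul_le_mul_of_nonneg_left (hm D.1 D.2 (by simpa [s] using hD)) h0
        exact Real.exp_le_exp.2 (by linarith)
    _ ≤ _ := by
        rw [Finset.sum_const, nsmul_eq_mul]
        exact mul_le_mul_of_nonneg_right hs (Real.exp_nonneg _)

/-- `M` supports a Latin set in the rows `R` with few uncovered positions in each row. -/
def HasRows (θ c : ℝ) (R : Finset (Fin n)) (M : Fin n × Fin n × Fin n → Bool) : Prop :=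
  ∃ L : Finset (Fin n × Fin n × Fin n), IsLatinSet L ∧ (∀ x ∈ L, x.1 ∈ R ∧ M x = true) ∧
    (n * R.card - L.card ≤ c * n ^ 2 * ((1 + 1 / (θ * n)) ^ R.card - 1)) ∧
    ∀ r ∈ R, n - c / θ * Real.exp (1 / θ) * n ≤ rowCard L r

lemma prob_not_hasRows_le {p θ c : ℝ} (h0 : 0 ≤ p) (h1 : p ≤ 1) (hθ : 0 < θ) (hc : 0 < c)
    (hn : 0 < n) (R : Finset (Fin n)) (hR : (R.card : ℝ) ≤ (1 - θ) * n) :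
    prob p (fun M => ¬ HasRows θ c R M) ≤
      R.card * (4 ^ n * Real.exp (-(p * (c * n ^ 2)))) := by
  have hn' : (0 : ℝ) < n := by exact_mod_cast hn
  induction R using Finset.induction_on with
  | empty =>
    have : (fun M : Fin n × Fin n × Fin n → Bool => ¬ HasRows θ c ∅ M) = fun _ => False := by
      ext M
      simp only [iff_false, not_not]
      exact ⟨∅, by simp [IsLatinSet], by simp, by simp, by simp⟩
    rw [this]
    simp [prob]
  | insert r R hr ih =>
    rw [Finset.card_insert_of_notMem hr] at hR ⊢
    push_cast at hR ⊢
    have hRθ : θ * n ≤ n - R.card := by linarith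
    have ih' := ih (by linarith)
    have hx1 : (1 : ℝ) ≤ 1 + 1 / (θ * n) := by
      have : 0 ≤ 1 / (θ * n) := by positivity
      linarith
    set X : ℝ := (1 + 1 / (θ * n)) ^ R.card with hX
    have hX1 : 1 ≤ X := one_le_pow₀ hx1
    have hXe : X ≤ Real.exp (1 / θ) := by
      calc X ≤ (Real.exp (1 / (θ * n))) ^ R.card := by
            refine pow_le_pow_left₀ (by linarith) ?_ _
            have := Real.add_one_le_exp (1 / (θ * n))
            linarith
        _ = Real.exp (R.card * (1 / (θ * n))) := by rw [Real.exp_nat_mul]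
        _ ≤ Real.exp (1 / θ) := by
            refine Real.exp_le_exp.2 ?_
            rw [mul_one_div, div_le_div_iff₀ (by positivity) hθ]
            have hRn : (R.card : ℝ) ≤ n := by
              exact_mod_cast (Finset.card_le_univ R).trans_eq (Fintype.card_fin n)
            nlinarith
    have hκ0 : 0 ≤ c * n / θ * X := by positivity
    have hκK : c * n / θ * X ≤ c / θ * Real.exp (1 / θ) * n := by
      have := mul_le_mul_of_nonneg_left hXe (show 0 ≤ c * n / θ by positivity)
      calc _ ≤ _ := this
        _ = _ := by ring
    rw [add_mul, one_mul]
    refine prob_not_le_add (p := p) (s := p) (t := p) (A := HasRows θ c R)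
      (E := HasRows θ c (insert r R)) h0 h1 h0 h1 (fun i a a' => if i.1 = r then a' else a)
      (fun i b => bern_select (P := i.1 = r) p b) ih' (by positivity) ?_
    rintro x ⟨L, hL, hLx, hLc, hLr⟩
    have hLR : ∀ y ∈ L, y.1 ∈ R := fun y hy => (hLx y hy).1
    refine le_trans (prob_mono h0 h1 ?_) (prob_avoid_rectangle_le h0 h1 L r
      (κ := c * n / θ * X) (m := c * n ^ 2) ?_)
    · intro y hy
      by_contra! hcon
      refine hy ?_
      obtain ⟨L', hL', hsub, hmem, hrow, hcard⟩ := exists_extend_row hL hLR hr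
        (M := fun i => if i.1 = r then y i else x i) hκ0 (by
          intro A B hAB
          obtain ⟨z, hz, hyz⟩ := hcon A B hAB
          exact ⟨z, hz, by simpa using hyz⟩)
      refine ⟨L', hL', ?_, ?_, ?_⟩
      · intro z hz
        rcases hmem z hz with h | h
        · have hzR := hLx z h
          have hne : z.1 ≠ r := by
            intro h'
            exact hr (h' ▸ hzR.1)
          exact ⟨Finset.mem_insert_of_mem hzR.1, by simp [hne, hzR.2]⟩
        · exact ⟨by simp [h.1], h.2⟩
      · rw [Finset.card_insert_of_notMem hr, hcard, pow_succ _ R.card, ← hX]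
        push_cast
        have : c * n ^ 2 * (X * (1 + 1 / (θ * n)) - 1)
            = c * n ^ 2 * (X - 1) + c * n / θ * X := by
          field_simp
          ring
        rw [this]
        linarith
      · intro r' hr'
        rcases Finset.mem_insert.1 hr' with rfl | hr'
        · linarith
        · have h2 : rowCard L r' ≤ rowCard L' r' :=
            Finset.card_le_card (Finset.filter_subset_filter _ hsub)
          have h3 : (rowCard L r' : ℝ) ≤ rowCard L' r' := by exact_mod_cast h2
          linarith [hLr r' hr']
    · intro A B hAB
      refine le_trans ?_ (le_card_freePairs hL hLR A B)
      have h3 : θ * n * (c * n / θ * X) ≤ (n - R.card) * (A.card + B.card - n) := by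
        refine mul_le_mul hRθ (by linarith) hκ0 ?_
        nlinarith
      have h4 : θ * n * (c * n / θ * X) = c * n ^ 2 * X := by
        field_simp
      linarith

end RowProcess

section Repair

variable {n : ℕ}

/-- `L₀` can be modified using entries of `Y` so that the rows in `R` become almost completely
covered, without uncovering too many positions in the other rows and in the columns. -/
def CanRepairRows (ε : ℝ) (L₀ : Finset (Fin n × Fin n × Fin n)) (R : Finset (Fin n))
    (Y : Fin n × Fin n × Fin n → Bool) : Prop :=
  ∃ L : Finset (Fin n × Fin n × Fin n), IsLatinSet L ∧ (∀ x ∈ L, x ∈ L₀ ∨ Y x = true) ∧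
    (∀ r ∈ R, n - ε * n ≤ rowCard L r) ∧
    (∀ r, r ∉ R → rowCard L₀ r - ε * n ≤ rowCard L r) ∧
    ∀ c, (colCard L₀ c : ℝ) - 2 * R.card ≤ colCard L c

/-- The entries in the rows `R` whose use would force `L₀` to give up a position of row `r`. -/
def conflicts (L₀ : Finset (Fin n × Fin n × Fin n)) (R : Finset (Fin n)) (r : Fin n) :
    Finset (Fin n × Fin n × Fin n) :=
  Finset.univ.filter (fun i => i.1 ∈ R ∧ (r, i.2) ∈ L₀)

lemma card_conflicts_le {L₀ : Finset (Fin n × Fin n × Fin n)} (hL₀ : IsLatinSet L₀)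
    (R : Finset (Fin n)) (r : Fin n) : (conflicts L₀ R r).card ≤ R.card * n := by
  have h : R.card * n = (R ×ˢ (Finset.univ : Finset (Fin n))).card := by simp
  rw [h]
  refine Finset.card_le_card_of_injOn (fun i => (i.1, i.2.1)) ?_ ?_
  · intro i hi
    simp only [conflicts, Finset.coe_filter, Finset.mem_univ, true_and, Set.mem_ofPred_eq] at hi
    simp [hi.1]
  · intro i hi j hj hij
    simp only [conflicts, Finset.coe_filter, Finset.mem_univ, true_and, Set.mem_ofPred_eq] at hi hj
    simp only [Prod.mk.injEq] at hij
    have := hL₀.1 _ hi.2 _ hj.2 rfl hij.2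
    exact Prod.ext hij.1 (Prod.ext_iff.1 this).2

lemma colCard_le_card {L : Finset (Fin n × Fin n × Fin n)} (hL : IsLatinSet L)
    {R : Finset (Fin n)} (c : Fin n) :
    (L.filter (fun x => x.2.1 = c ∧ x.1 ∈ R)).card ≤ R.card := by
  refine Finset.card_le_card_of_injOn (fun x => x.1) ?_ ?_
  · intro x hx
    simp only [Finset.coe_filter, Set.mem_ofPred_eq] at hx
    exact hx.2.2
  · intro x hx y hy hxy
    simp only [Finset.coe_filter, Set.mem_ofPred_eq] at hx hy
    exact hL.1 x hx.1 y hy.1 hxy (hx.2.1.trans hy.2.1.symm)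

lemma canRepairRows_of_hasRows {θ c ε : ℝ} (hε : c / θ * Real.exp (1 / θ) ≤ ε)
    {L₀ : Finset (Fin n × Fin n × Fin n)} (hL₀ : IsLatinSet L₀) {R : Finset (Fin n)}
    {Y : Fin n × Fin n × Fin n → Bool} (hY : HasRows θ c R Y)
    (hhit : ∀ r, (((conflicts L₀ R r).filter (fun i => Y i = true)).card : ℝ) ≤ ε * n) :
    CanRepairRows ε L₀ R Y := by
  obtain ⟨L₂, hL₂, hL₂Y, -, hrow⟩ := hY
  set K := L₀.filter (fun x => x.1 ∉ R ∧ ∀ z ∈ L₂, z.2 ≠ x.2) with hK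
  have hKmem : ∀ x, x ∈ K ↔ x ∈ L₀ ∧ x.1 ∉ R ∧ ∀ z ∈ L₂, z.2 ≠ x.2 := fun x => by simp [hK]
  have hrows : ∀ x ∈ L₂, ∀ y ∈ K, x.1 ≠ y.1 := by
    intro x hx y hy hxy
    exact ((hKmem y).1 hy).2.1 (hxy ▸ (hL₂Y x hx).1)
  have hpairs : ∀ x ∈ L₂, ∀ y ∈ K, x.2 ≠ y.2 := fun x hx y hy => ((hKmem y).1 hy).2.2 x hx
  refine ⟨L₂ ∪ K, ⟨?_, ?_, ?_⟩, ?_, ?_, ?_, ?_⟩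
  · intro x hx y hy h1 h2
    rcases Finset.mem_union.1 hx with hx | hx <;> rcases Finset.mem_union.1 hy with hy | hy
    · exact hL₂.1 x hx y hy h1 h2
    · exact absurd h1 (hrows x hx y hy)
    · exact absurd h1.symm (hrows y hy x hx)
    · exact hL₀.1 x ((hKmem x).1 hx).1 y ((hKmem y).1 hy).1 h1 h2
  · intro x hx y hy h1 h2
    rcases Finset.mem_union.1 hx with hx | hx <;> rcases Finset.mem_union.1 hy with hy | hy
    · exact hL₂.2.1 x hx y hy h1 h2
    · exact absurd h1 (hrows x hx y hy)
    · exact absurd h1.symm (hrows y hy x hx)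
    · exact hL₀.2.1 x ((hKmem x).1 hx).1 y ((hKmem y).1 hy).1 h1 h2
  · intro x hx y hy h1 h2
    rcases Finset.mem_union.1 hx with hx | hx <;> rcases Finset.mem_union.1 hy with hy | hy
    · exact hL₂.2.2 x hx y hy h1 h2
    · exact absurd (Prod.ext h1 h2) (hpairs x hx y hy)
    · exact absurd (Prod.ext h1 h2).symm (hpairs y hy x hx)
    · exact hL₀.2.2 x ((hKmem x).1 hx).1 y ((hKmem y).1 hy).1 h1 h2
  · intro x hx
    rcases Finset.mem_union.1 hx with hx | hx
    · exact Or.inr (hL₂Y x hx).2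
    · exact Or.inl ((hKmem x).1 hx).1
  · intro r hr
    have h2 : rowCard L₂ r ≤ rowCard (L₂ ∪ K) r :=
      Finset.card_le_card (Finset.filter_subset_filter _ Finset.subset_union_left)
    have h3 : (rowCard L₂ r : ℝ) ≤ rowCard (L₂ ∪ K) r := by exact_mod_cast h2
    have h4 := mul_le_mul_of_nonneg_right hε (Nat.cast_nonneg (α := ℝ) n)
    linarith [hrow r hr]
  · intro r hr
    have h1 : rowCard L₀ r ≤ rowCard (L₂ ∪ K) r +
        ((conflicts L₀ R r).filter (fun i => Y i = true)).card := by
      have hsub : L₀.filter (fun x => x.1 = r) ⊆ (L₂ ∪ K).filter (fun x => x.1 = r) ∪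
          ((conflicts L₀ R r).filter (fun i => Y i = true)).image (fun i => (r, i.2)) := by
        intro x hx
        replace hx := Finset.mem_filter.1 hx
        obtain ⟨hx, rfl⟩ := hx
        rw [Finset.mem_union]
        by_cases hz : ∀ z ∈ L₂, z.2 ≠ x.2
        · left
          exact Finset.mem_filter.2 ⟨Finset.mem_union_right _ ((hKmem x).2 ⟨hx, hr, hz⟩), rfl⟩
        · right
          push Not at hz
          obtain ⟨z, hz, hzx⟩ := hz
          refine Finset.mem_image.2 ⟨z, ?_, by rw [hzx]⟩
          simp only [conflicts, Finset.mem_filter, Finset.mem_univ, true_and]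
          exact ⟨⟨(hL₂Y z hz).1, by rwa [hzx]⟩, (hL₂Y z hz).2⟩
      refine (Finset.card_le_card hsub).trans ((Finset.card_union_le _ _).trans ?_)
      exact Nat.add_le_add_left Finset.card_image_le _
    have h2 : (rowCard L₀ r : ℝ) ≤ rowCard (L₂ ∪ K) r +
        ((conflicts L₀ R r).filter (fun i => Y i = true)).card := by exact_mod_cast h1
    linarith [hhit r]
  · intro c
    have h1 : colCard L₀ c ≤ colCard (L₂ ∪ K) c + (R.card + R.card) := by
      have hsub : L₀.filter (fun x => x.2.1 = c) ⊆ (L₂ ∪ K).filter (fun x => x.2.1 = c) ∪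
          (L₀.filter (fun x => x.2.1 = c ∧ x.1 ∈ R) ∪
            L₀.filter (fun x => x.2 ∈
              (L₂.filter (fun x => x.2.1 = c ∧ x.1 ∈ R)).image (fun x => x.2))) := by
        intro x hx
        replace hx := Finset.mem_filter.1 hx
        obtain ⟨hx, rfl⟩ := hx
        rw [Finset.mem_union, Finset.mem_union]
        by_cases hr : x.1 ∈ R
        · right; left
          exact Finset.mem_filter.2 ⟨hx, rfl, hr⟩
        by_cases hz : ∀ z ∈ L₂, z.2 ≠ x.2
        · left
          exact Finset.mem_filter.2 ⟨Finset.mem_union_right _ ((hKmem x).2 ⟨hx, hr, hz⟩), rfl⟩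
        · right; right
          push Not at hz
          obtain ⟨z, hz, hzx⟩ := hz
          refine Finset.mem_filter.2 ⟨hx, Finset.mem_image.2 ⟨z, ?_, hzx⟩⟩
          exact Finset.mem_filter.2 ⟨hz, by rw [hzx], (hL₂Y z hz).1⟩
      refine (Finset.card_le_card hsub).trans ((Finset.card_union_le _ _).trans ?_)
      refine Nat.add_le_add_left ((Finset.card_union_le _ _).trans (Nat.add_le_add ?_ ?_)) _
      · exact colCard_le_card hL₀ c
      · exact (card_filter_pair_le hL₀ _).trans
          (Finset.card_image_le.trans (colCard_le_card hL₂ c))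
    have h2 : (colCard L₀ c : ℝ) ≤ colCard (L₂ ∪ K) c + (R.card + R.card) := by exact_mod_cast h1
    linarith

lemma prob_not_canRepairRows_le {p θ c ε u : ℝ} (h0 : 0 ≤ p) (h1 : p ≤ 1) (hθ : 0 < θ)
    (hc : 0 < c) (hn : 0 < n) (hu : 0 ≤ u) (hε : c / θ * Real.exp (1 / θ) ≤ ε)
    {L₀ : Finset (Fin n × Fin n × Fin n)} (hL₀ : IsLatinSet L₀) {R : Finset (Fin n)}
    (hR : (R.card : ℝ) ≤ (1 - θ) * n) :
    prob p (fun Y => ¬ CanRepairRows ε L₀ R Y) ≤ n * (4 ^ n * Real.exp (-(p * (c * n ^ 2))))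
      + n * Real.exp (p * (Real.exp u - 1) * (R.card * n) - u * (ε * n)) := by
  have hu1 : 0 ≤ Real.exp u - 1 := by linarith [Real.one_le_exp hu]
  calc _ ≤ prob p (fun Y => ¬ HasRows θ c R Y ∨ ∃ r ∈ (Finset.univ : Finset (Fin n)),
        ε * n < ((conflicts L₀ R r).filter (fun i => Y i = true)).card) := by
        refine prob_mono h0 h1 fun Y hY => ?_
        by_contra! hcon
        exact hY (canRepairRows_of_hasRows hε hL₀ hcon.1 fun r => hcon.2 r (Finset.mem_univ r))
    _ ≤ _ := prob_or_le h0 h1 _ _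
    _ ≤ _ := by
        refine add_le_add ((prob_not_hasRows_le h0 h1 hθ hc hn R hR).trans ?_)
          ((prob_exists_le h0 h1 _ _).trans ?_)
        · have : (R.card : ℝ) ≤ n := by
            exact_mod_cast (Finset.card_le_univ R).trans_eq (Fintype.card_fin n)
          exact mul_le_mul_of_nonneg_right this (by positivity)
        · calc _ ≤ ∑ r : Fin n, Real.exp (p * (Real.exp u - 1) * (R.card * n) - u * (ε * n)) := by
                refine Finset.sum_le_sum fun r _ => (prob_le_card_filter_le h0 h1 hu _).trans ?_
                refine Real.exp_le_exp.2 (sub_le_sub_right ?_ _)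
                refine mul_le_mul_of_nonneg_left ?_ (mul_nonneg h0 hu1)
                exact_mod_cast card_conflicts_le hL₀ R r
            _ = _ := by simp

/-- Exchanging rows and columns. -/
def swapRC (n : ℕ) : (Fin n × Fin n × Fin n) ≃ (Fin n × Fin n × Fin n) where
  toFun x := (x.2.1, x.1, x.2.2)
  invFun x := (x.2.1, x.1, x.2.2)
  left_inv _ := rfl
  right_inv _ := rfl

/-- The transpose of a set of triples. -/
def transposeSet (L : Finset (Fin n × Fin n × Fin n)) : Finset (Fin n × Fin n × Fin n) :=
  L.map (swapRC n).toEmbedding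

lemma mem_transposeSet {L : Finset (Fin n × Fin n × Fin n)} {x : Fin n × Fin n × Fin n} :
    x ∈ transposeSet L ↔ swapRC n x ∈ L := by
  rw [transposeSet, Finset.mem_map_equiv]
  rfl

lemma rowCard_transposeSet (L : Finset (Fin n × Fin n × Fin n)) (r : Fin n) :
    rowCard (transposeSet L) r = colCard L r := by
  rw [rowCard, colCard, transposeSet, Finset.filter_map, Finset.card_map]
  rfl

lemma colCard_transposeSet (L : Finset (Fin n × Fin n × Fin n)) (c : Fin n) :
    colCard (transposeSet L) c = rowCard L c := by
  rw [rowCard, colCard, transposeSet, Finset.filter_map, Finset.card_map]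
  rfl

lemma IsLatinSet.transposeSet {L : Finset (Fin n × Fin n × Fin n)} (hL : IsLatinSet L) :
    IsLatinSet (transposeSet L) := by
  refine ⟨?_, ?_, ?_⟩ <;> intro x hx y hy h1 h2 <;> rw [mem_transposeSet] at hx hy <;>
    apply (swapRC n).injective
  · exact hL.1 _ hx _ hy h2 h1
  · exact hL.2.2 _ hx _ hy h1 h2
  · exact hL.2.1 _ hx _ hy h1 h2

end Repair

section Assembly

variable {n : ℕ}

/-- `M` supports a Latin set leaving at most `α` positions uncovered in all rows but `m` and at
most `β` positions uncovered in all columns but `m'`. -/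
def NearlyCovered (m m' α β : ℝ) (M : Fin n × Fin n × Fin n → Bool) : Prop :=
  ∃ (L : Finset (Fin n × Fin n × Fin n)) (R S : Finset (Fin n)), IsLatinSet L ∧
    (∀ x ∈ L, M x = true) ∧ (R.card ≤ m) ∧ (S.card ≤ m') ∧
    (∀ r, r ∉ R → n - α ≤ rowCard L r) ∧ ∀ c, c ∉ S → n - β ≤ colCard L c

lemma NearlyCovered.swap {m m' α β : ℝ} {M : Fin n × Fin n × Fin n → Bool}
    (h : NearlyCovered m m' α β M) : NearlyCovered m' m β α (M ∘ swapRC n) := by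
  obtain ⟨L, R, S, hL, hLM, hR, hS, hrow, hcol⟩ := h
  refine ⟨transposeSet L, S, R, hL.transposeSet, ?_, hS, hR, ?_, ?_⟩
  · intro x hx
    exact hLM _ (mem_transposeSet.1 hx)
  · intro r hr
    rw [rowCard_transposeSet]
    exact hcol r hr
  · intro c hc
    rw [colCard_transposeSet]
    exact hrow c hc

lemma prob_not_nearlyCovered_swap (p m m' α β : ℝ) :
    prob p (fun M : Fin n × Fin n × Fin n → Bool => ¬ NearlyCovered m m' α β M)
      = prob p (fun M : Fin n × Fin n × Fin n → Bool => ¬ NearlyCovered m' m β α M) := by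
  rw [← prob_comp_equiv p (swapRC n)]
  congr 1
  ext M
  refine not_congr ⟨fun h => ?_, fun h => h.swap⟩
  simpa [Function.comp_assoc, show (swapRC n : _ → _) ∘ swapRC n = id from rfl] using h.swap

lemma NearlyCovered.mono {m m' α β α' β' : ℝ} {M M' : Fin n × Fin n × Fin n → Bool}
    (h : NearlyCovered m m' α β M) (hM : ∀ x, M x = true → M' x = true) (hα : α ≤ α')
    (hβ : β ≤ β') : NearlyCovered m m' α' β' M' := by
  obtain ⟨L, R, S, hL, hLM, hR, hS, hrow, hcol⟩ := h
  exact ⟨L, R, S, hL, fun x hx => hM x (hLM x hx), hR, hS,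
    fun r hr => by linarith [hrow r hr], fun c hc => by linarith [hcol c hc]⟩

lemma prob_not_nearlyCovered_repair_rows {p s a b m m' α β ε : ℝ} (hp0 : 0 ≤ p) (hp1 : p ≤ 1)
    (hs0 : 0 ≤ s) (hs1 : s ≤ 1) (hα : 0 ≤ α) (hb0 : 0 ≤ b)
    (ha : prob p (fun M : Fin n × Fin n × Fin n → Bool => ¬ NearlyCovered m m' α β M) ≤ a)
    (hb : ∀ (L : Finset (Fin n × Fin n × Fin n)) (R : Finset (Fin n)), IsLatinSet L →
      R.card ≤ m → prob s (fun Y => ¬ CanRepairRows ε L R Y) ≤ b) :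
    prob (p + s - p * s) (fun M : Fin n × Fin n × Fin n → Bool =>
      ¬ NearlyCovered 0 m' (α + ε * n) (β + 2 * m) M) ≤ a + b := by
  refine prob_not_le_add (A := NearlyCovered m m' α β)
    (E := NearlyCovered 0 m' (α + ε * n) (β + 2 * m)) hp0 hp1 hs0 hs1 (fun _ a a' => a || a')
    (fun _ c => bern_or p s c) ha hb0 ?_
  rintro x ⟨L, R, S, hL, hLM, hR, hS, hrow, hcol⟩
  refine le_trans (prob_mono hs0 hs1 (F := fun Y => ¬ CanRepairRows ε L R Y)
    fun y hy hrep => hy ?_) (hb L R hL hR)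
  obtain ⟨L', hL', hmem, hR', hrow', hcol'⟩ := hrep
  refine ⟨L', ∅, S, hL', ?_, by simp, hS, ?_, ?_⟩
  · intro z hz
    rcases hmem z hz with h | h
    · simp [hLM z h]
    · simp [h]
  · intro r _
    by_cases hr : r ∈ R
    · linarith [hR' r hr]
    · linarith [hrow' r hr, hrow r hr]
  · intro c hc
    linarith [hcol' c, hcol c hc]

lemma nearlyCovered_of_hasRows {σ η θ c : ℝ} (hη : 0 < η) (hσ1 : σ ≤ 1)
    (hc : c / θ * Real.exp (1 / θ) ≤ σ * η) (hn : 0 < n)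
    {R : Finset (Fin n)} (hR : n - σ * n ≤ R.card) {M : Fin n × Fin n × Fin n → Bool}
    (h : HasRows θ c R M) :
    NearlyCovered (σ * n) (σ * n) (η * n) (η * n + σ * n) M := by
  have hn' : (0 : ℝ) < n := by exact_mod_cast hn
  obtain ⟨L, hL, hLM, -, hrow⟩ := h
  have hrow' : ∀ r ∈ R, n - σ * η * n ≤ rowCard L r := fun r hr => by
    have := mul_le_mul_of_nonneg_right hc hn'.le
    linarith [hrow r hr]
  have hRn : (R.card : ℝ) ≤ n := by
    exact_mod_cast (Finset.card_le_univ R).trans_eq (Fintype.card_fin n)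
  set S := Finset.univ.filter (fun c => (colCard L c : ℝ) < n - (η * n + σ * n)) with hS
  refine ⟨L, Rᶜ, S, hL, fun x hx => (hLM x hx).2, ?_, ?_, ?_, ?_⟩
  · rw [Finset.card_compl, Fintype.card_fin, Nat.cast_sub (by exact_mod_cast hRn)]
    linarith
  · have h1 : L.card = ∑ r ∈ R, rowCard L r :=
      Finset.card_eq_sum_card_fiberwise fun x hx => (hLM x hx).1
    have h2 : L.card = ∑ c, colCard L c :=
      Finset.card_eq_sum_card_fiberwise fun x _ => Finset.mem_univ x.2.1
    have h3 : (R.card : ℝ) * (n - σ * η * n) ≤ L.card := by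
      rw [h1, ← nsmul_eq_mul, ← Finset.sum_const]
      push_cast
      exact Finset.sum_le_sum hrow'
    have h4 : (L.card : ℝ) ≤ n * R.card - S.card * (η * n) := by
      have hcol : ∀ c, (colCard L c : ℝ) ≤ R.card - if c ∈ S then η * n else 0 := by
        intro c
        have h5 : colCard L c ≤ R.card := by
          refine le_trans (Finset.card_le_card fun x hx => ?_) (colCard_le_card (R := R) hL c)
          obtain ⟨hx, hxc⟩ := Finset.mem_filter.1 hx
          exact Finset.mem_filter.2 ⟨hx, hxc, (hLM x hx).1⟩
        have h6 : (colCard L c : ℝ) ≤ R.card := by exact_mod_cast h5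
        by_cases hcS : c ∈ S
        · have h7 := (Finset.mem_filter.1 hcS).2
          simp only [hcS, if_true]
          linarith
        · simpa [hcS] using h5
      calc (L.card : ℝ) = ∑ c, (colCard L c : ℝ) := by rw [h2]; push_cast; rfl
        _ ≤ ∑ c, ((R.card : ℝ) - if c ∈ S then η * n else 0) :=
          Finset.sum_le_sum fun c _ => hcol c
        _ = _ := by
          rw [Finset.sum_sub_distrib, Finset.sum_ite_mem]
          simp
    have h5 : (S.card : ℝ) * (η * n) ≤ R.card * (σ * η * n) := by linarith
    have h6 : 0 ≤ σ * η * n ∨ σ * η * n < 0 := le_or_gt _ _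
    rcases h6 with h6 | h6
    · have h7 : (S.card : ℝ) * (η * n) ≤ (σ * n) * (η * n) := by
        calc _ ≤ R.card * (σ * η * n) := h5
          _ ≤ n * (σ * η * n) := mul_le_mul_of_nonneg_right hRn h6
          _ = _ := by ring
      exact le_of_mul_le_mul_right h7 (by positivity)
    · have h7 : σ < 0 := by
        by_contra! h8
        exact absurd h6 (not_lt.2 (by positivity))
      have h8 : (n : ℝ) - σ * n ≤ n := hR.trans hRn
      nlinarith
  · intro r hr
    rw [Finset.mem_compl, not_not] at hr
    have := mul_le_mul_of_nonneg_right hσ1 (mul_pos hη hn').le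
    linarith [hrow' r hr]
  · intro c hc
    simpa [hS] using hc

lemma four_pow_mul_exp_le (n : ℕ) : (4 : ℝ) ^ n * Real.exp (-(3 * n)) ≤ Real.exp (-n) := by
  have h4 : (4 : ℝ) ≤ Real.exp 2 := by
    have h := Real.exp_one_gt_d9
    have : Real.exp 2 = Real.exp 1 * Real.exp 1 := by rw [← Real.exp_add]; norm_num
    nlinarith
  calc (4 : ℝ) ^ n * Real.exp (-(3 * n)) ≤ Real.exp 2 ^ n * Real.exp (-(3 * n)) := by gcongr
    _ = Real.exp (-n) := by
      rw [← Real.exp_nat_mul, ← Real.exp_add]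
      ring_nf

lemma prob_not_nearlyCovered_le {p σ η c : ℝ} (hp0 : 0 ≤ p) (hp1 : p ≤ 1) (hσ : 0 < σ)
    (hσ1 : σ ≤ 1) (hη : 0 < η) (hc : 0 < c)
    (hcσ : c / (σ / 2) * Real.exp (1 / (σ / 2)) ≤ σ * η) (hn : 0 < n) (hnσ : 2 / σ ≤ n)
    (hpn : p * (c * n ^ 2) = 3 * n) :
    prob p (fun M : Fin n × Fin n × Fin n → Bool =>
      ¬ NearlyCovered (σ * n) (σ * n) (η * n) (η * n + σ * n) M) ≤ n * Real.exp (-n) := by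
  have hn' : (0 : ℝ) < n := by exact_mod_cast hn
  have hσn : 0 < σ * n := mul_pos hσ hn'
  have hfl : ⌊(1 - σ / 2) * n⌋₊ ≤ (Finset.univ : Finset (Fin n)).card := by
    rw [Finset.card_univ, Fintype.card_fin]
    refine Nat.floor_le_of_le ?_
    linarith
  obtain ⟨R, -, hRc⟩ := Finset.exists_subset_card_eq hfl
  have hR1 : (R.card : ℝ) ≤ (1 - σ / 2) * n := by
    rw [hRc]
    exact Nat.floor_le (mul_nonneg (by linarith) hn'.le)
  have hR2 : n - σ * n ≤ R.card := by
    rw [hRc]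
    have h1 := Nat.lt_floor_add_one ((1 - σ / 2) * n)
    have h2 : 2 ≤ n * σ := (div_le_iff₀ hσ).1 hnσ
    linarith
  have hRn : (R.card : ℝ) ≤ n := by linarith
  refine (prob_mono hp0 hp1 (F := fun M => ¬ HasRows (σ / 2) c R M)
    fun M hM hrows => hM (nearlyCovered_of_hasRows hη hσ1 hcσ hn hR2 hrows)).trans
    ((prob_not_hasRows_le hp0 hp1 (half_pos hσ) hc hn R hR1).trans ?_)
  rw [hpn]
  exact mul_le_mul hRn (four_pow_mul_exp_le n) (by positivity) hn'.le

lemma prob_not_canRepairRows_le_exp {p σ η c : ℝ} (hp0 : 0 ≤ p) (hp1 : p ≤ 1)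
    (hσ1 : σ ≤ 1 / 2) (hη : 0 < η) (hc : 0 < c)
    (hcη : c / (1 / 2) * Real.exp (1 / (1 / 2)) ≤ η)
    (hcσ : 3 / c * (Real.exp (3 / η) - 1) * σ ≤ 1) (hn : 0 < n) (hpn : p = 3 / c / n)
    {L : Finset (Fin n × Fin n × Fin n)} {R : Finset (Fin n)} (hL : IsLatinSet L)
    (hR : R.card ≤ σ * n) :
    prob p (fun Y => ¬ CanRepairRows η L R Y) ≤ 2 * (n * Real.exp (-n)) := by
  have hn' : (0 : ℝ) < n := by exact_mod_cast hn
  have hu : 0 ≤ Real.exp (3 / η) - 1 := by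
    linarith [Real.one_le_exp (show 0 ≤ 3 / η by positivity)]
  have hR1 : (R.card : ℝ) ≤ (1 - 1 / 2) * n := by
    have := mul_le_mul_of_nonneg_right hσ1 hn'.le
    linarith
  refine (prob_not_canRepairRows_le hp0 hp1 (by norm_num : (0 : ℝ) < 1 / 2) hc hn
    (show 0 ≤ 3 / η by positivity) hcη hL hR1).trans ?_
  rw [show p * (c * n ^ 2) = 3 * n by rw [hpn]; field_simp]
  have h1 : (n : ℝ) * (4 ^ n * Real.exp (-(3 * n))) ≤ n * Real.exp (-n) :=
    mul_le_mul_of_nonneg_left (four_pow_mul_exp_le n) hn'.le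
  have h2 : p * (Real.exp (3 / η) - 1) * (R.card * n) - 3 / η * (η * n) ≤ -n := by
    have h3 : p * (Real.exp (3 / η) - 1) * (R.card * n) ≤ n := by
      calc _ ≤ p * (Real.exp (3 / η) - 1) * (σ * n * n) := by gcongr
        _ = 3 / c * (Real.exp (3 / η) - 1) * σ * n := by rw [hpn]; field_simp
        _ ≤ 1 * n := mul_le_mul_of_nonneg_right hcσ hn'.le
        _ = n := one_mul _
    have h4 : 3 / η * (η * n) = 3 * n := by field_simp
    linarith
  have h3 := mul_le_mul_of_nonneg_left (Real.exp_le_exp.2 h2) hn'.le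
  linarith

lemma sprinkle_mem_Icc {p s : ℝ} (hp0 : 0 ≤ p) (hp1 : p ≤ 1) (hs0 : 0 ≤ s) (hs1 : s ≤ 1) :
    0 ≤ p + s - p * s ∧ p + s - p * s ≤ 1 ∧ p + s - p * s ≤ p + s := by
  have := mul_nonneg hp0 hs0
  have := mul_nonneg (sub_nonneg.2 hp1) (sub_nonneg.2 hs1)
  have := mul_nonneg hp0 (sub_nonneg.2 hs1)
  refine ⟨?_, ?_, ?_⟩ <;> linarith

/-- Repairing first the uncovered rows and then the uncovered columns. -/
lemma prob_not_nearlyCovered_repair {p s m α β ε a b q γ : ℝ} (hp0 : 0 ≤ p) (hp1 : p ≤ 1)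
    (hs0 : 0 ≤ s) (hs1 : s ≤ 1) (hm : 0 ≤ m) (hα : 0 ≤ α) (hβ : 0 ≤ β) (hb0 : 0 ≤ b)
    (ha : prob p (fun M : Fin n × Fin n × Fin n → Bool => ¬ NearlyCovered m m α β M) ≤ a)
    (hb : ∀ (L : Finset (Fin n × Fin n × Fin n)) (R : Finset (Fin n)), IsLatinSet L →
      R.card ≤ m → prob s (fun Y => ¬ CanRepairRows ε L R Y) ≤ b)
    (hlt : p + s + s < 1) (hq : p + s + s ≤ q) (hq1 : q ≤ 1) (hγα : α + ε * n + 2 * m ≤ γ)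
    (hγβ : β + 2 * m + ε * n ≤ γ) :
    prob q (fun M : Fin n × Fin n × Fin n → Bool => ¬ NearlyCovered 0 0 γ γ M) ≤ a + b + b := by
  have h1 := prob_not_nearlyCovered_repair_rows (m := m) (m' := m) hp0 hp1 hs0 hs1 hα hb0 ha hb
  rw [prob_not_nearlyCovered_swap] at h1
  obtain ⟨ht0, ht1, hts⟩ := sprinkle_mem_Icc hp0 hp1 hs0 hs1
  have h2 := prob_not_nearlyCovered_repair_rows (m := m) (m' := 0) (α := β + 2 * m)
    (β := α + ε * n) ht0 ht1 hs0 hs1 (by positivity) hb0 h1 hb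
  obtain ⟨hv0, hv1, hvs⟩ := sprinkle_mem_Icc ht0 ht1 hs0 hs1
  generalize p + s - p * s + s - (p + s - p * s) * s = v at *
  refine (prob_mono_param (E := NearlyCovered (n := n) 0 0 γ γ) hv0
    (by linarith) (by linarith) hq1
    (fun x y h => h.mono (fun z hz => by simp [hz]) le_rfl le_rfl)).trans (le_trans ?_ h2)
  exact prob_mono hv0 hv1 fun M hM hcov => hM (hcov.mono (fun _ h => h) hγβ hγα)

/-- With density `D / n`, for a suitable constant `D`, the array nearly covers all rows and
columns with high probability. -/
lemma exists_density (γ : ℝ) (hγ : 0 < γ) :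
    ∃ D : ℝ, ∃ N : ℕ, ∀ n : ℕ, N ≤ n → ∀ q : ℝ, D ≤ q * n → q ≤ 1 →
      prob q (fun M : Fin n × Fin n × Fin n → Bool => ¬ NearlyCovered 0 0 (γ * n) (γ * n) M)
        ≤ 5 * (n * Real.exp (-n)) := by
  obtain ⟨η, hη, hηγ⟩ : ∃ η : ℝ, 0 < η ∧ 5 * η = γ := ⟨γ / 5, by positivity, by ring⟩
  obtain ⟨c₂, hc₂, hc₂η⟩ : ∃ c : ℝ, 0 < c ∧ c / (1 / 2) * Real.exp (1 / (1 / 2)) = η :=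
    ⟨η * (1 / 2) / Real.exp (1 / (1 / 2)), by positivity, by field_simp⟩
  obtain ⟨σ, hσ, hσ1, hση, hσD⟩ : ∃ σ : ℝ, 0 < σ ∧ σ ≤ 1 / 2 ∧ σ ≤ η ∧
      3 / c₂ * (Real.exp (3 / η) - 1) * σ ≤ 1 := by
    have hu : 0 ≤ Real.exp (3 / η) - 1 := by
      linarith [Real.one_le_exp (show 0 ≤ 3 / η by positivity)]
    have hT : 0 ≤ 3 / c₂ * (Real.exp (3 / η) - 1) := by positivity
    refine ⟨min (min (1 / 2) η) (1 / (3 / c₂ * (Real.exp (3 / η) - 1) + 1)), by positivity,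
      (min_le_left _ _).trans (min_le_left _ _), (min_le_left _ _).trans (min_le_right _ _), ?_⟩
    refine (mul_le_mul_of_nonneg_left (min_le_right _ _) hT).trans ?_
    rw [mul_one_div, div_le_one (by positivity)]
    linarith
  obtain ⟨c₁, hc₁, hc₁σ⟩ : ∃ c : ℝ, 0 < c ∧ c / (σ / 2) * Real.exp (1 / (σ / 2)) = σ * η :=
    ⟨σ * η * (σ / 2) / Real.exp (1 / (σ / 2)), by positivity, by field_simp⟩
  obtain ⟨D, hD⟩ : ∃ D : ℝ, D = 3 / c₁ + 3 / c₂ + 3 / c₂ := ⟨_, rfl⟩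
  refine ⟨D, ⌈D⌉₊ + ⌈2 / σ⌉₊ + 1, fun n hn q hq hq1 => ?_⟩
  have hnD : D < n := by
    refine (Nat.le_ceil D).trans_lt ?_
    exact_mod_cast (show ⌈D⌉₊ < n by omega)
  have hnσ : 2 / σ ≤ n := by
    refine (Nat.le_ceil _).trans ?_
    exact_mod_cast (show ⌈2 / σ⌉₊ ≤ n by omega)
  have hn0 : 0 < n := by omega
  have hn' : (0 : ℝ) < n := by exact_mod_cast hn0
  have hDn : D / n < 1 := (div_lt_one hn').2 hnD
  have hqD : D / n ≤ q := (div_le_iff₀ hn').2 hq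
  have hp₁0 : 0 ≤ 3 / c₁ / n := by positivity
  have hp₂0 : 0 ≤ 3 / c₂ / n := by positivity
  have hsum : 3 / c₁ / n + 3 / c₂ / n + 3 / c₂ / n = D / n := by rw [hD]; ring
  have hp₁1 : 3 / c₁ / n ≤ 1 := by linarith
  have hp₂1 : 3 / c₂ / n ≤ 1 := by linarith
  have hσn := mul_le_mul_of_nonneg_right hση hn'.le
  have hηn := mul_pos hη hn'
  have bulk := prob_not_nearlyCovered_le hp₁0 hp₁1 hσ (by linarith) hη hc₁ hc₁σ.le hn0 hnσ
    (by field_simp)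
  refine (prob_not_nearlyCovered_repair (m := σ * n) (α := η * n) (β := η * n + σ * n) (ε := η)
    hp₁0 hp₁1 hp₂0 hp₂1 (by positivity) (by positivity) (by positivity)
    (by positivity : 0 ≤ 2 * (n * Real.exp (-n))) bulk
    (fun L R hL hR => prob_not_canRepairRows_le_exp hp₂0 hp₂1 hσ1 hη hc₂ hc₂η.le hσD hn0 rfl hL hR)
    (hsum.trans_lt hDn) (hsum.trans_le hqD) hq1 ?_ ?_).trans_eq (by ring)
  all_goals rw [← hηγ]; linarith

lemma arrProb_eq_prob (q : ℝ) (P : (Fin n → Fin n → Fin n → Bool) → Prop) :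
    arrProb n n n q P =
      prob q (fun M : Fin n × Fin n × Fin n → Bool => P fun r c v => M (r, c, v)) := by
  unfold arrProb prob
  refine Finset.sum_nbij' (fun M x => M x.1 x.2.1 x.2.2) (fun M r c v => M (r, c, v))
    (fun _ _ => @Finset.mem_univ _ (_) _) (fun _ _ => @Finset.mem_univ _ (_) _) (fun _ _ => rfl)
    (fun _ _ => rfl) fun M _ => ?_
  simp only [weight, bern, Fintype.prod_prod_type]

/-- The partial Latin box whose covered positions are given by a Latin set. -/
lemma exists_partialLatinBox_s13 {M : Fin n × Fin n × Fin n → Bool} {α : ℝ}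
    (h : NearlyCovered 0 0 α α M) :
    ∃ B : Fin n → Fin n → Option (Fin n),
      IsPartialLatinBox B ∧ SupportsPartial (fun r c v => M (r, c, v)) B ∧
      (∀ r, ((Finset.univ.filter (fun c => B r c = none)).card : ℝ) ≤ α) ∧
      (∀ c, ((Finset.univ.filter (fun r => B r c = none)).card : ℝ) ≤ α) := by
  obtain ⟨L, R, S, hL, hLM, hR, hS, hrow, hcol⟩ := h
  have hR0 : R = ∅ := by
    rw [← Finset.card_eq_zero]
    exact Nat.le_zero.1 (by exact_mod_cast hR)
  have hS0 : S = ∅ := by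
    rw [← Finset.card_eq_zero]
    exact Nat.le_zero.1 (by exact_mod_cast hS)
  subst hR0 hS0
  let B : Fin n → Fin n → Option (Fin n) := fun r c =>
    if h : ∃ v, (r, c, v) ∈ L then some h.choose else none
  have hB : ∀ r c v, B r c = some v ↔ (r, c, v) ∈ L := by
    intro r c v
    by_cases h : ∃ v, (r, c, v) ∈ L
    · have hBh : B r c = some h.choose := dif_pos h
      rw [hBh, Option.some_inj]
      constructor
      · rintro rfl; exact h.choose_spec
      · intro hv
        have := hL.1 _ h.choose_spec _ hv rfl rfl
        simpa using this
    · have hBh : B r c = none := dif_neg h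
      rw [hBh]
      constructor
      · intro h'; simp at h'
      · intro h'; exact absurd ⟨v, h'⟩ h
  refine ⟨B, ⟨?_, ?_⟩, ?_, ?_, ?_⟩
  · intro r c c' v hcc h1 h2
    have := hL.2.1 _ ((hB _ _ _).1 h1) _ ((hB _ _ _).1 h2) rfl rfl
    simp only [Prod.mk.injEq] at this
    exact hcc this.2.1
  · intro r r' c v hrr h1 h2
    have := hL.2.2 _ ((hB _ _ _).1 h1) _ ((hB _ _ _).1 h2) rfl rfl
    simp only [Prod.mk.injEq] at this
    exact hrr this.1
  · intro r c v h
    exact hLM _ ((hB r c v).1 h)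
  · intro r
    have h1 : rowCard L r ≤ (Finset.univ.filter (fun c => ¬ B r c = none)).card := by
      refine Finset.card_le_card_of_injOn (fun x => x.2.1) ?_ ?_
      · rintro ⟨r', c, v⟩ hx
        simp only [Finset.coe_filter, Set.mem_ofPred_eq] at hx
        obtain ⟨hx, rfl⟩ := hx
        simp [(hB _ _ _).2 hx]
      · intro x hx y hy hxy
        simp only [Finset.coe_filter, Set.mem_ofPred_eq] at hx hy
        exact hL.1 x hx.1 y hy.1 (hx.2.trans hy.2.symm) hxy
    have h2 := Finset.card_filter_add_card_filter_not (s := Finset.univ) (fun c => B r c = none)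
    rw [Finset.card_univ, Fintype.card_fin] at h2
    have h3 : ((Finset.univ.filter (fun c => B r c = none)).card : ℝ) + rowCard L r ≤ n := by
      exact_mod_cast (show (Finset.univ.filter (fun c => B r c = none)).card + rowCard L r ≤ n by
        omega)
    linarith [hrow r (by simp)]
  · intro c
    have h1 : colCard L c ≤ (Finset.univ.filter (fun r => ¬ B r c = none)).card := by
      refine Finset.card_le_card_of_injOn (fun x => x.1) ?_ ?_
      · rintro ⟨r, c', v⟩ hx
        simp only [Finset.coe_filter, Set.mem_ofPred_eq] at hx
        obtain ⟨hx, rfl⟩ := hx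
        simp [(hB _ _ _).2 hx]
      · intro x hx y hy hxy
        simp only [Finset.coe_filter, Set.mem_ofPred_eq] at hx hy
        exact hL.1 x hx.1 y hy.1 hxy (hx.2.trans hy.2.symm)
    have h2 := Finset.card_filter_add_card_filter_not (s := Finset.univ) (fun r => B r c = none)
    rw [Finset.card_univ, Fintype.card_fin] at h2
    have h3 : ((Finset.univ.filter (fun r => B r c = none)).card : ℝ) + colCard L c ≤ n := by
      exact_mod_cast (show (Finset.univ.filter (fun r => B r c = none)).card + colCard L c ≤ n by
        omega)
    linarith [hcol c (by simp)]

end Assembly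

/-- If `q·n → ∞` and `M ~ M(n,n,n;q)`, then for every `γ > 0`, w.h.p. `M` supports a
partial Latin box leaving at most `γn` positions uncovered in each row and column. -/
theorem stmt13 (q : ℕ → ℝ) (hq0 : ∀ n, 0 ≤ q n) (hq1 : ∀ n, q n ≤ 1)
    (hq : Filter.Tendsto (fun n : ℕ => q n * n) Filter.atTop Filter.atTop)
    (γ : ℝ) (hγ : 0 < γ) :
    Filter.Tendsto (fun n : ℕ =>
      arrProb n n n (q n) (fun M => ∃ B : Fin n → Fin n → Option (Fin n),
        IsPartialLatinBox B ∧ SupportsPartial M B ∧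
        (∀ r, ((Finset.univ.filter (fun c => B r c = none)).card : ℝ) ≤ γ * n) ∧
        (∀ c, ((Finset.univ.filter (fun r => B r c = none)).card : ℝ) ≤ γ * n)))
      Filter.atTop (nhds 1) := by
  obtain ⟨D, N, hD⟩ := exists_density γ hγ
  have hlim : Filter.Tendsto (fun n : ℕ => 1 - 5 * ((n : ℝ) * Real.exp (-n)))
      Filter.atTop (nhds 1) := by
    have h := (Real.tendsto_pow_mul_exp_neg_atTop_nhds_zero 1).comp
      (tendsto_natCast_atTop_atTop (R := ℝ))
    simpa using (h.const_mul 5).const_sub 1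
  refine tendsto_of_tendsto_of_tendsto_of_le_of_le' hlim tendsto_const_nhds ?_ ?_
  · filter_upwards [Filter.eventually_ge_atTop N, hq.eventually_ge_atTop D] with n hn hqn
    have h1 := hD n hn (q n) hqn (hq1 n)
    have h2 := prob_add_prob_not (q n)
      (NearlyCovered (n := n) 0 0 (γ * n) (γ * n))
    rw [arrProb_eq_prob]
    refine le_trans (by linarith) (prob_mono (hq0 n) (hq1 n) fun M hM => exists_partialLatinBox_s13 hM)
  · filter_upwards with n
    rw [arrProb_eq_prob]
    exact prob_le_one (hq0 n) (hq1 n) _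

end
end
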